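/- arXiv:0904.1710 — 2 statements merged into one kernel-verified Lean document; each statement's English description precedes it below -/
import Mathlib

section
/- Let 1 ≤ p ≤ 2 and q ≥ 1. For all matrices Y ∈ M_n ⊗ M_m, ‖Y‖_{NC:p,q} ≤ 2^{3 − 1/p} · ‖Y‖_{CL}. -/
open scoped Kronecker
open Matrix
open scoped ENNReal NNReal ComplexOrder

noncomputable section

open scoped Classical in
/-- The Schatten `p`-norm of a complex square matrix, `p ∈ [1,∞]` (as an `ℝ≥0∞`).
For finite `p` it equals `(Tr |A|^p)^{1/p}`, computed via the eigenvalues of `Aᴴ * A`;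
for `p = ∞` it is the operator norm (largest singular value). -/
noncomputable def schattenNorm {k : Type*} [Fintype k] [DecidableEq k] (p : ℝ≥0∞)
    (A : Matrix k k ℂ) : ℝ :=
  if p = ⊤ then
    ⨆ i, Real.sqrt ((Matrix.posSemidef_conjTranspose_mul_self A).isHermitian.eigenvalues i)
  else
    (∑ i, (Matrix.posSemidef_conjTranspose_mul_self A).isHermitian.eigenvalues i
        ^ (p.toReal / 2)) ^ (1 / p.toReal)

/-- `r` defined by `1/r = max{1/p, 1/q} - min{1/p, 1/q}` (so `r = ∞` when `p = q`). -/
noncomputable def ncR (p q : ℝ≥0∞) : ℝ≥0∞ := (max p⁻¹ q⁻¹ - min p⁻¹ q⁻¹)⁻¹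

/-- The non-commutative `L^q(L^p)` norm (supremum form, used when `p ≤ q`):
`sup_{A,B} ‖(A ⊗ I) Y (B ⊗ I)‖_p / (‖A‖_{2r} ‖B‖_{2r})`. -/
noncomputable def ncNormSup {k l : Type*} [Fintype k] [DecidableEq k] [Fintype l] [DecidableEq l]
    (p q : ℝ≥0∞) (Y : Matrix (k × l) (k × l) ℂ) : ℝ :=
  ⨆ A : Matrix k k ℂ, ⨆ B : Matrix k k ℂ,
    schattenNorm p ((A ⊗ₖ (1 : Matrix l l ℂ)) * Y * (B ⊗ₖ (1 : Matrix l l ℂ))) /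
      (schattenNorm (2 * ncR p q) A * schattenNorm (2 * ncR p q) B)

/-- The non-commutative `L^q(L^p)` norm (infimum form, used when `q ≤ p`):
`inf { ∑ᵢ ‖Aᵢ‖_{2r} ‖Bᵢ‖_{2r} ‖Zᵢ‖_p : Y = ∑ᵢ (Aᵢ ⊗ I) Zᵢ (Bᵢ ⊗ I) }`. -/
noncomputable def ncNormInf {k l : Type*} [Fintype k] [DecidableEq k] [Fintype l] [DecidableEq l]
    (p q : ℝ≥0∞) (Y : Matrix (k × l) (k × l) ℂ) : ℝ :=
  sInf { s : ℝ | ∃ (N : ℕ) (A B : Fin N → Matrix k k ℂ)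
      (Z : Fin N → Matrix (k × l) (k × l) ℂ),
    Y = ∑ i, (A i ⊗ₖ (1 : Matrix l l ℂ)) * Z i * (B i ⊗ₖ (1 : Matrix l l ℂ)) ∧
    s = ∑ i, schattenNorm (2 * ncR p q) (A i) * schattenNorm (2 * ncR p q) (B i) *
          schattenNorm p (Z i) }

open scoped Classical in
/-- The non-commutative `L^q(L^p)` norm `‖·‖_{NC:p,q}`. -/
noncomputable def ncNorm {k l : Type*} [Fintype k] [DecidableEq k] [Fintype l] [DecidableEq l]
    (p q : ℝ≥0∞) (Y : Matrix (k × l) (k × l) ℂ) : ℝ :=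
  if p ≤ q then ncNormSup p q Y else ncNormInf p q Y

open scoped Classical in
/-- Real power of a Hermitian matrix via the spectral decomposition (junk value `0` on
non-Hermitian matrices). -/
noncomputable def mrpow {k : Type*} [Fintype k] [DecidableEq k] (A : Matrix k k ℂ) (e : ℝ) :
    Matrix k k ℂ :=
  if hA : A.IsHermitian then
    (hA.eigenvectorUnitary : Matrix k k ℂ) *
      Matrix.diagonal (fun i => ((hA.eigenvalues i ^ e : ℝ) : ℂ)) *
      ((hA.eigenvectorUnitary : Matrix k k ℂ))ᴴ
  else 0

/-- Partial trace over the second (inside) factor. -/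
noncomputable def ptrace2 {k l : Type*} [Fintype l]
    (Y : Matrix (k × l) (k × l) ℂ) : Matrix k k ℂ :=
  fun i i' => ∑ j : l, Y (i, j) (i', j)

/-- The Carlen–Lieb quantity `Ψ_{p,q}(Y) = (Tr₁ (Tr₂ Y^p)^{q/p})^{1/q}`. -/
noncomputable def Psi {k l : Type*} [Fintype k] [DecidableEq k] [Fintype l] [DecidableEq l]
    (p q : ℝ) (Y : Matrix (k × l) (k × l) ℂ) : ℝ :=
  (Matrix.trace (mrpow (ptrace2 (mrpow Y p)) (q / p))).re ^ (1 / q)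

/-- The quantity `|||X|||_{p,q} = inf {Ψ_{p,q}(A) + Ψ_{p,q}(B) : X + A = B, A ≥ 0, B ≥ 0}`,
for `X` on the space `M_k ⊗ (M_l ⊗ M_2)`. -/
noncomputable def tripleNorm {k l : Type*} [Fintype k] [DecidableEq k] [Fintype l] [DecidableEq l]
    (p q : ℝ) (X : Matrix (k × (l × Fin 2)) (k × (l × Fin 2)) ℂ) : ℝ :=
  sInf { s : ℝ | ∃ A B : Matrix (k × (l × Fin 2)) (k × (l × Fin 2)) ℂ,
    A.PosSemidef ∧ B.PosSemidef ∧ X + A = B ∧ s = Psi p q A + Psi p q B }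

/-- The block matrix `[[0, Y],[Yᴴ, 0]]`, viewed in `M_k ⊗ (M_l ⊗ M_2)`. -/
noncomputable def clBlock {k l : Type*} (Y : Matrix (k × l) (k × l) ℂ) :
    Matrix (k × (l × Fin 2)) (k × (l × Fin 2)) ℂ :=
  fun x y =>
    if x.2.2 = 0 ∧ y.2.2 = 1 then Y (x.1, x.2.1) (y.1, y.2.1)
    else if x.2.2 = 1 ∧ y.2.2 = 0 then star (Y (y.1, y.2.1) (x.1, x.2.1))
    else 0

/-- The block-diagonal matrix `diag(P, Q) = [[P, 0],[0, Q]]`, viewed in `M_k ⊗ (M_l ⊗ M_2)`. -/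
noncomputable def blockDiag2 {k l : Type*} (P Q : Matrix (k × l) (k × l) ℂ) :
    Matrix (k × (l × Fin 2)) (k × (l × Fin 2)) ℂ :=
  fun x y =>
    if x.2.2 = 0 ∧ y.2.2 = 0 then P (x.1, x.2.1) (y.1, y.2.1)
    else if x.2.2 = 1 ∧ y.2.2 = 1 then Q (x.1, x.2.1) (y.1, y.2.1)
    else 0

/-- The Carlen–Lieb norm `‖Y‖_{CL} = (1/2) ||| [[0,Y],[Yᴴ,0]] |||_{p,q}`. -/
noncomputable def clNorm {k l : Type*} [Fintype k] [DecidableEq k] [Fintype l] [DecidableEq l]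
    (p q : ℝ) (Y : Matrix (k × l) (k × l) ℂ) : ℝ :=
  (1 / 2) * tripleNorm p q (clBlock Y)

end

/-! ### A complex-valued functional calculus for Hermitian matrices -/

section SpectralCalculus

variable {k : Type*} [Fintype k] [DecidableEq k]

open scoped Classical in
/-- The functional calculus of a Hermitian matrix for complex-valued functions (junk value `0` on
non-Hermitian matrices). -/
noncomputable def spectralMap (A : Matrix k k ℂ) (f : ℝ → ℂ) : Matrix k k ℂ :=
  if hA : A.IsHermitian then
    (hA.eigenvectorUnitary : Matrix k k ℂ) * Matrix.diagonal (fun i => f (hA.eigenvalues i)) *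
      ((hA.eigenvectorUnitary : Matrix k k ℂ))ᴴ
  else 0

variable {A : Matrix k k ℂ}

theorem spectralMap_eq (hA : A.IsHermitian) (f : ℝ → ℂ) :
    spectralMap A f = (hA.eigenvectorUnitary : Matrix k k ℂ) *
      Matrix.diagonal (fun i => f (hA.eigenvalues i)) *
      ((hA.eigenvectorUnitary : Matrix k k ℂ))ᴴ := by
  simp [spectralMap, hA]

theorem eigenvectorUnitary_conjTranspose_mul_self (hA : A.IsHermitian) :
    ((hA.eigenvectorUnitary : Matrix k k ℂ))ᴴ * (hA.eigenvectorUnitary : Matrix k k ℂ) = 1 :=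
  Unitary.coe_star_mul_self hA.eigenvectorUnitary

theorem eigenvectorUnitary_mul_conjTranspose_self (hA : A.IsHermitian) :
    (hA.eigenvectorUnitary : Matrix k k ℂ) * ((hA.eigenvectorUnitary : Matrix k k ℂ))ᴴ = 1 :=
  Unitary.coe_mul_star_self hA.eigenvectorUnitary

theorem spectralMap_congr (hA : A.IsHermitian) {f g : ℝ → ℂ}
    (h : ∀ i, f (hA.eigenvalues i) = g (hA.eigenvalues i)) :
    spectralMap A f = spectralMap A g := by
  simp [spectralMap_eq hA, h]

theorem spectralMap_congr_of_posSemidef (hA : A.PosSemidef) {f g : ℝ → ℂ}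
    (h : ∀ x, 0 ≤ x → f x = g x) : spectralMap A f = spectralMap A g :=
  spectralMap_congr hA.isHermitian fun i => h _ (hA.eigenvalues_nonneg i)

theorem spectralMap_mul (hA : A.IsHermitian) (f g : ℝ → ℂ) :
    spectralMap A f * spectralMap A g = spectralMap A (fun x => f x * g x) := by
  simp only [spectralMap_eq hA]
  rw [← Matrix.diagonal_mul_diagonal]
  simp only [Matrix.mul_assoc]
  rw [← Matrix.mul_assoc (_ᴴ) (_ : Matrix k k ℂ), eigenvectorUnitary_conjTranspose_mul_self,
    Matrix.one_mul]

theorem spectralMap_sub (hA : A.IsHermitian) (f g : ℝ → ℂ) :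
    spectralMap A f - spectralMap A g = spectralMap A (fun x => f x - g x) := by
  simp only [spectralMap_eq hA, ← Matrix.diagonal_sub, Matrix.mul_sub, Matrix.sub_mul]

theorem spectralMap_conjTranspose (hA : A.IsHermitian) (f : ℝ → ℂ) :
    (spectralMap A f)ᴴ = spectralMap A (fun x => star (f x)) := by
  simp only [spectralMap_eq hA, Matrix.conjTranspose_mul, Matrix.conjTranspose_conjTranspose,
    Matrix.diagonal_conjTranspose, Matrix.mul_assoc]
  rfl

theorem spectralMap_one (hA : A.IsHermitian) : spectralMap A (fun _ => 1) = 1 := by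
  simp [spectralMap_eq hA, eigenvectorUnitary_mul_conjTranspose_self]

theorem spectralMap_id (hA : A.IsHermitian) : spectralMap A (fun x => (x : ℂ)) = A := by
  conv_rhs => rw [hA.spectral_theorem]
  rw [spectralMap_eq hA, Unitary.conjStarAlgAut_apply]
  rfl

theorem spectralMap_mul_self (hA : A.IsHermitian) (f : ℝ → ℂ) :
    spectralMap A f * A = spectralMap A (fun x => f x * x) := by
  rw [← spectralMap_mul hA, spectralMap_id hA]

theorem self_mul_spectralMap (hA : A.IsHermitian) (f : ℝ → ℂ) :
    A * spectralMap A f = spectralMap A (fun x => x * f x) := by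
  rw [← spectralMap_mul hA, spectralMap_id hA]

theorem trace_spectralMap (hA : A.IsHermitian) (f : ℝ → ℂ) :
    (spectralMap A f).trace = ∑ i, f (hA.eigenvalues i) := by
  rw [spectralMap_eq hA, Matrix.trace_mul_cycle, eigenvectorUnitary_conjTranspose_mul_self,
    Matrix.one_mul, Matrix.trace_diagonal]

theorem spectralMap_posSemidef (hA : A.IsHermitian) {f : ℝ → ℂ}
    (h : ∀ i, 0 ≤ f (hA.eigenvalues i)) : (spectralMap A f).PosSemidef := by
  rw [spectralMap_eq hA]
  exact (Matrix.posSemidef_diagonal_iff.2 h).mul_mul_conjTranspose_same _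

theorem mrpow_eq_spectralMap (hA : A.IsHermitian) (e : ℝ) :
    mrpow A e = spectralMap A (fun x => ((x ^ e : ℝ) : ℂ)) := by
  simp [mrpow, spectralMap, hA]

theorem spectralMap_ofReal_eq_cfc (hA : A.IsHermitian) (f : ℝ → ℝ) :
    spectralMap A (fun x => (f x : ℂ)) = cfc f A := by
  rw [hA.cfc_eq, Matrix.IsHermitian.cfc, Unitary.conjStarAlgAut_apply, spectralMap_eq hA]
  rfl

theorem mrpow_spectralMap (hA : A.IsHermitian) (f : ℝ → ℝ) (e : ℝ) :
    mrpow (spectralMap A (fun x => (f x : ℂ))) e =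
      spectralMap A (fun x => ((f x ^ e : ℝ) : ℂ)) := by
  have hH : (spectralMap A (fun x => (f x : ℂ))).IsHermitian := by
    rw [Matrix.IsHermitian, spectralMap_conjTranspose hA]
    simp
  rw [mrpow_eq_spectralMap hH, spectralMap_ofReal_eq_cfc hH, spectralMap_ofReal_eq_cfc hA,
    spectralMap_ofReal_eq_cfc hA (fun x => f x ^ e)]
  have hfin := A.finite_real_spectrum
  exact (cfc_comp (fun x : ℝ => x ^ e) f A hA ((hfin.image f).continuousOn _)
    (hfin.continuousOn _)).symm

theorem trace_mrpow (hA : A.IsHermitian) (e : ℝ) :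
    (mrpow A e).trace.re = ∑ i, hA.eigenvalues i ^ e := by
  rw [mrpow_eq_spectralMap hA, trace_spectralMap hA, Complex.re_sum]
  simp

theorem trace_mrpow_nonneg (hA : A.PosSemidef) (e : ℝ) : 0 ≤ (mrpow A e).trace.re := by
  rw [trace_mrpow hA.isHermitian]
  exact Finset.sum_nonneg fun i _ => Real.rpow_nonneg (hA.eigenvalues_nonneg i) e

theorem mrpow_posSemidef (hA : A.PosSemidef) (e : ℝ) : (mrpow A e).PosSemidef := by
  rw [mrpow_eq_spectralMap hA.isHermitian]
  refine spectralMap_posSemidef hA.isHermitian fun i => ?_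
  exact_mod_cast Real.rpow_nonneg (hA.eigenvalues_nonneg i) e

end SpectralCalculus

/-! ### Complex powers of nonnegative reals, entire in the exponent -/

section ComplexPower

/-- The complex power `x ^ w` of `x ≥ 0`, with the convention `0 ^ w = 0` for every `w`. -/
noncomputable def realCpow (w : ℂ) (x : ℝ) : ℂ :=
  if x = 0 then 0 else Complex.exp (w * (Real.log x : ℂ))

theorem realCpow_add (v w : ℂ) (x : ℝ) :
    realCpow (v + w) x = realCpow v x * realCpow w x := by
  unfold realCpow
  split_ifs <;> simp [add_mul, Complex.exp_add]

theorem star_realCpow (w : ℂ) (x : ℝ) : star (realCpow w x) = realCpow (star w) x := by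
  unfold realCpow
  split_ifs
  · simp
  · simp [← Complex.exp_conj]

theorem realCpow_ofReal {r : ℝ} (hr : r ≠ 0) {x : ℝ} (hx : 0 ≤ x) :
    realCpow r x = ((x ^ r : ℝ) : ℂ) := by
  unfold realCpow
  split_ifs with h
  · simp [h, Real.zero_rpow hr]
  · rw [Real.rpow_def_of_pos (lt_of_le_of_ne hx (Ne.symm h))]
    push_cast
    ring_nf

theorem realCpow_one {x : ℝ} (hx : 0 ≤ x) : realCpow 1 x = x := by
  simpa using realCpow_ofReal one_ne_zero hx

theorem realCpow_zero_mul {x : ℝ} (v : ℂ) : realCpow 0 x * realCpow v x = realCpow v x := by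
  rw [← realCpow_add, zero_add]

theorem realCpow_zero_le_one (x : ℝ) : realCpow 0 x ≤ 1 := by
  unfold realCpow
  split_ifs <;> simp

theorem norm_realCpow_le {w : ℂ} {R : ℝ} (hw : |w.re| ≤ R) (x : ℝ) :
    ‖realCpow w x‖ ≤ Real.exp (R * |Real.log x|) := by
  unfold realCpow
  split_ifs
  · simp [Real.exp_nonneg]
  · rw [Complex.norm_exp, Real.exp_le_exp]
    simp only [Complex.mul_re, Complex.ofReal_re, Complex.ofReal_im, mul_zero, sub_zero]
    exact (le_abs_self _).trans ((abs_mul _ _).le.trans (by gcongr))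

theorem differentiable_realCpow (x : ℝ) : Differentiable ℂ fun w => realCpow w x := by
  unfold realCpow
  split_ifs
  · exact differentiable_const _
  · fun_prop

end ComplexPower

/-! ### Contractions and the Hilbert–Schmidt norm -/

section HilbertSchmidt

variable {a b c : Type*} [Fintype a] [Fintype b] [Fintype c]

/-- The squared Hilbert–Schmidt norm. -/
noncomputable def hsSq (A : Matrix a b ℂ) : ℝ := (Aᴴ * A).trace.re

theorem hsSq_eq_sum (A : Matrix a b ℂ) : hsSq A = ∑ x : b × a, ‖A x.2 x.1‖ ^ 2 := by
  rw [Fintype.sum_prod_type, hsSq, Matrix.trace, Complex.re_sum]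
  refine Finset.sum_congr rfl fun j _ => ?_
  rw [Matrix.diag_apply, Matrix.mul_apply, Complex.re_sum]
  refine Finset.sum_congr rfl fun i _ => ?_
  rw [Matrix.conjTranspose_apply, Complex.star_def, ← Complex.normSq_eq_conj_mul_self,
    Complex.ofReal_re, Complex.normSq_eq_norm_sq]

theorem hsSq_nonneg (A : Matrix a b ℂ) : 0 ≤ hsSq A := by
  rw [hsSq_eq_sum]
  positivity

theorem hsSq_conjTranspose (A : Matrix a b ℂ) : hsSq Aᴴ = hsSq A := by
  rw [hsSq, hsSq, Matrix.conjTranspose_conjTranspose, Matrix.trace_mul_comm]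

theorem norm_trace_mul_le (A : Matrix a b ℂ) (B : Matrix b a ℂ) :
    ‖(A * B).trace‖ ≤ Real.sqrt (hsSq A) * Real.sqrt (hsSq B) := by
  rw [← hsSq_conjTranspose A, hsSq_eq_sum, hsSq_eq_sum]
  refine le_trans ?_ (Real.sum_mul_le_sqrt_mul_sqrt Finset.univ
    (fun x : a × b => ‖Aᴴ x.2 x.1‖) (fun x : a × b => ‖B x.2 x.1‖))
  rw [Fintype.sum_prod_type, Matrix.trace]
  refine (norm_sum_le _ _).trans (Finset.sum_le_sum fun i _ => ?_)
  rw [Matrix.diag_apply, Matrix.mul_apply]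
  refine (norm_sum_le _ _).trans (Finset.sum_le_sum fun j _ => ?_)
  simp

/-- `K` is a contraction between Euclidean spaces: `Kᴴ K ≤ 1`. -/
def IsContraction [DecidableEq b] (K : Matrix a b ℂ) : Prop := (1 - Kᴴ * K).PosSemidef

variable [DecidableEq a] [DecidableEq b]

omit [DecidableEq a] in
theorem IsContraction.hsSq_mul_le {K : Matrix a b ℂ} (hK : IsContraction K) (A : Matrix b c ℂ) :
    hsSq (K * A) ≤ hsSq A := by
  have h := (hK.conjTranspose_mul_mul_same A).trace_nonneg
  rw [Matrix.mul_sub, Matrix.sub_mul, Matrix.trace_sub, Matrix.mul_one] at h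
  have h' := (Complex.le_def.1 h).1
  simp only [Complex.sub_re, Complex.zero_re] at h'
  have h2 : (K * A)ᴴ * (K * A) = Aᴴ * (Kᴴ * K) * A := by
    simp only [Matrix.conjTranspose_mul, Matrix.mul_assoc]
  rw [hsSq, h2, hsSq]
  linarith

omit [DecidableEq a] in
theorem isContraction_of_hsSq_mul_le {K : Matrix a b ℂ}
    (h : ∀ A : Matrix b Unit ℂ, hsSq (K * A) ≤ hsSq A) : IsContraction K := by
  refine Matrix.PosSemidef.of_dotProduct_mulVec_nonneg
    (Matrix.isHermitian_one.sub (Matrix.isHermitian_conjTranspose_mul_self K)) fun x => ?_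
  let X : Matrix b Unit ℂ := fun i _ => x i
  have h1 : star x ⬝ᵥ (1 - Kᴴ * K) *ᵥ x = (Xᴴ * X).trace - ((K * X)ᴴ * (K * X)).trace := by
    rw [← Matrix.trace_sub, Matrix.conjTranspose_mul, Matrix.mul_assoc, ← Matrix.mul_assoc Kᴴ,
      ← Matrix.mul_sub]
    nth_rw 2 [← Matrix.one_mul X]
    rw [← Matrix.sub_mul]
    rw [Matrix.trace, Finset.univ_unique, Finset.sum_singleton]
    rfl
  have h2 := (Complex.le_def.1 (Matrix.posSemidef_conjTranspose_mul_self X).trace_nonneg).2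
  have h3 := (Complex.le_def.1 (Matrix.posSemidef_conjTranspose_mul_self (K * X)).trace_nonneg).2
  have h4 := h X
  rw [h1, Complex.le_def]
  simp only [hsSq] at h4
  simp only [Complex.sub_re, Complex.sub_im, ← h2, ← h3, Complex.zero_re, Complex.zero_im]
  exact ⟨by linarith, by simp⟩

theorem IsContraction.conjTranspose {K : Matrix a b ℂ} (hK : IsContraction K) :
    IsContraction Kᴴ := by
  refine isContraction_of_hsSq_mul_le fun A => ?_
  have h1 : hsSq (Kᴴ * A) ≤ Real.sqrt (hsSq A) * Real.sqrt (hsSq (Kᴴ * A)) := by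
    have h2 : hsSq (Kᴴ * A) = (Aᴴ * (K * (Kᴴ * A))).trace.re := by
      rw [hsSq]
      simp only [Matrix.conjTranspose_mul, Matrix.conjTranspose_conjTranspose, Matrix.mul_assoc]
    rw [h2]
    refine (Complex.re_le_norm _).trans ((norm_trace_mul_le _ _).trans ?_)
    rw [hsSq_conjTranspose, ← h2]
    gcongr
    exact hK.hsSq_mul_le _
  have h3 := hsSq_nonneg A
  have h4 := hsSq_nonneg (Kᴴ * A)
  have h5 := Real.sq_sqrt h3
  have h6 := Real.sq_sqrt h4
  have h7 := Real.sqrt_nonneg (hsSq A)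
  have h8 := Real.sqrt_nonneg (hsSq (Kᴴ * A))
  by_contra! hlt
  have h9 := Real.sqrt_lt_sqrt h3 hlt
  nlinarith

omit [DecidableEq a] in
theorem IsContraction.mul [DecidableEq c] {K : Matrix a b ℂ} {L : Matrix b c ℂ}
    (hK : IsContraction K) (hL : IsContraction L) : IsContraction (K * L) := by
  have h := (hK.conjTranspose_mul_mul_same L).add hL
  unfold IsContraction
  convert h using 1
  simp only [Matrix.conjTranspose_mul, Matrix.mul_sub, Matrix.sub_mul, Matrix.mul_assoc,
    Matrix.mul_one]
  abel

omit [DecidableEq a] in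
theorem IsContraction.kronecker_one [DecidableEq c] {K : Matrix a b ℂ} (hK : IsContraction K) :
    IsContraction (K ⊗ₖ (1 : Matrix c c ℂ)) := by
  have h := Matrix.PosSemidef.kronecker hK (Matrix.PosSemidef.one (n := c) (R := ℂ))
  unfold IsContraction
  have h2 : 1 - (K ⊗ₖ (1 : Matrix c c ℂ))ᴴ * (K ⊗ₖ (1 : Matrix c c ℂ)) =
      (1 - Kᴴ * K) ⊗ₖ (1 : Matrix c c ℂ) := by
    rw [Matrix.conjTranspose_kronecker, ← Matrix.mul_kronecker_mul, Matrix.conjTranspose_one,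
      Matrix.one_mul, ← Matrix.one_kronecker_one]
    ext i j
    simp only [Matrix.sub_apply, Matrix.kroneckerMap_apply]
    ring
  rwa [h2]

end HilbertSchmidt

/-! ### Powers of the modulus of a matrix in its polar decomposition -/

section PolarPower

variable {k : Type*} [Fintype k] [DecidableEq k]

/-- `U |C| ^ w`, where `C = U |C|` is the polar decomposition of `C`. -/
noncomputable def polarPow (C : Matrix k k ℂ) (w : ℂ) : Matrix k k ℂ :=
  C * spectralMap (Cᴴ * C) (realCpow ((w - 1) / 2))

theorem isContraction_spectralMap_realCpow {A : Matrix k k ℂ} (hA : A.IsHermitian) {w : ℂ}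
    (hw : w.re = 0) : IsContraction (spectralMap A (realCpow w)) := by
  unfold IsContraction
  rw [spectralMap_conjTranspose hA, spectralMap_mul hA, ← spectralMap_one hA, spectralMap_sub hA]
  refine spectralMap_posSemidef hA fun i => ?_
  rw [star_realCpow, ← realCpow_add]
  have h : star w + w = 0 := by
    apply Complex.ext <;> simp [hw]
  rw [h]
  exact sub_nonneg.2 (realCpow_zero_le_one _)

theorem polarPow_add (C : Matrix k k ℂ) (v w : ℂ) :
    polarPow C (v + w) = polarPow C v * spectralMap (Cᴴ * C) (realCpow (w / 2)) := by
  unfold polarPow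
  rw [Matrix.mul_assoc, spectralMap_mul (Matrix.isHermitian_conjTranspose_mul_self C)]
  congr 2
  ext x
  rw [← realCpow_add]
  ring_nf

theorem conjTranspose_polarPow_star (C : Matrix k k ℂ) (w : ℂ) :
    (polarPow C (star w))ᴴ = spectralMap (Cᴴ * C) (realCpow ((w - 1) / 2)) * Cᴴ := by
  rw [polarPow, Matrix.conjTranspose_mul,
    spectralMap_conjTranspose (Matrix.isHermitian_conjTranspose_mul_self C)]
  congr 2
  ext x
  rw [star_realCpow]
  simp

theorem conjTranspose_polarPow_star_mul (C : Matrix k k ℂ) (w : ℂ) :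
    (polarPow C (star w))ᴴ * C = spectralMap (Cᴴ * C) (realCpow ((w + 1) / 2)) := by
  have hH := Matrix.isHermitian_conjTranspose_mul_self C
  rw [conjTranspose_polarPow_star, Matrix.mul_assoc, spectralMap_mul_self hH]
  refine spectralMap_congr_of_posSemidef (Matrix.posSemidef_conjTranspose_mul_self C) fun x hx => ?_
  rw [← realCpow_one hx, ← realCpow_add]
  ring_nf

theorem conjTranspose_polarPow_mul_self (C : Matrix k k ℂ) (w : ℂ) :
    (polarPow C w)ᴴ * polarPow C w = spectralMap (Cᴴ * C) (realCpow (w.re : ℂ)) := by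
  have hH := Matrix.isHermitian_conjTranspose_mul_self C
  have h := conjTranspose_polarPow_star_mul C (star w)
  rw [star_star] at h
  nth_rw 2 [polarPow]
  rw [← Matrix.mul_assoc, h, spectralMap_mul hH]
  congr 1
  ext x
  rw [← realCpow_add]
  congr 1
  apply Complex.ext <;> simp <;> ring

theorem isContraction_polarPow (C : Matrix k k ℂ) {w : ℂ} (hw : w.re = 0) :
    IsContraction (polarPow C w) := by
  have hH := Matrix.isHermitian_conjTranspose_mul_self C
  unfold IsContraction
  rw [conjTranspose_polarPow_mul_self, hw, ← spectralMap_one hH, spectralMap_sub hH]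
  exact spectralMap_posSemidef hH fun i => sub_nonneg.2 (realCpow_zero_le_one _)

theorem polarPow_one (C : Matrix k k ℂ) : polarPow C 1 = C := by
  have hH := Matrix.isHermitian_conjTranspose_mul_self C
  have h0 : polarPow C 1 = C * spectralMap (Cᴴ * C) (realCpow 0) := by simp [polarPow]
  have h1 : Cᴴ * C * spectralMap (Cᴴ * C) (realCpow 0) = Cᴴ * C := by
    conv_rhs => rw [← spectralMap_id hH]
    rw [self_mul_spectralMap hH]
    refine spectralMap_congr_of_posSemidef (Matrix.posSemidef_conjTranspose_mul_self C)
      fun x hx => ?_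
    rw [← realCpow_one hx, mul_comm, realCpow_zero_mul]
  have h2 : Cᴴ * (C * spectralMap (Cᴴ * C) (realCpow 0) - C) = 0 := by
    rw [Matrix.mul_sub, ← Matrix.mul_assoc, h1, sub_self]
  have h3 : (C * spectralMap (Cᴴ * C) (realCpow 0) - C)ᴴ *
      (C * spectralMap (Cᴴ * C) (realCpow 0) - C) = 0 := by
    rw [Matrix.conjTranspose_sub, Matrix.conjTranspose_mul, Matrix.sub_mul, Matrix.mul_assoc, h2,
      Matrix.mul_zero, sub_zero]
  rw [h0]
  exact sub_eq_zero.1 (Matrix.conjTranspose_mul_self_eq_zero.1 h3)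

end PolarPower

/-! ### Entire matrix families bounded on a strip -/

section Strip

variable {a b c : Type*} [Fintype a] [Fintype b] [Fintype c]

/-- All entries of `f` are entire functions that are bounded on the strip `0 ≤ re z ≤ 1`. -/
def EntireBddOnStrip (f : ℂ → Matrix a b ℂ) : Prop :=
  ∀ i j, (Differentiable ℂ fun z => f z i j) ∧
    ∃ R : ℝ, ∀ z : ℂ, 0 ≤ z.re → z.re ≤ 1 → ‖f z i j‖ ≤ R

omit [Fintype a] [Fintype b] in
theorem EntireBddOnStrip.const (A : Matrix a b ℂ) : EntireBddOnStrip fun _ => A :=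
  fun i j => ⟨differentiable_const _, ‖A i j‖, fun _ _ _ => le_rfl⟩

omit [Fintype a] [Fintype c] in
theorem EntireBddOnStrip.mul {f : ℂ → Matrix a b ℂ} {g : ℂ → Matrix b c ℂ}
    (hf : EntireBddOnStrip f) (hg : EntireBddOnStrip g) :
    EntireBddOnStrip fun z => f z * g z := by
  intro i j
  choose hfd F hF using hf
  choose hgd G hG using hg
  simp only [Matrix.mul_apply]
  refine ⟨Differentiable.fun_sum fun l _ => (hfd i l).mul (hgd l j), ∑ l, F i l * G l j,
    fun z h0 h1 => (norm_sum_le _ _).trans (Finset.sum_le_sum fun l _ => ?_)⟩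
  rw [norm_mul]
  exact mul_le_mul (hF i l z h0 h1) (hG l j z h0 h1) (norm_nonneg _)
    ((norm_nonneg _).trans (hF i l z h0 h1))

omit [Fintype a] [Fintype b] [Fintype c] in
theorem EntireBddOnStrip.kronecker_one [DecidableEq c] {f : ℂ → Matrix a b ℂ}
    (hf : EntireBddOnStrip f) : EntireBddOnStrip fun z => f z ⊗ₖ (1 : Matrix c c ℂ) := by
  intro i j
  obtain ⟨hd, R, hR⟩ := hf i.1 j.1
  simp only [Matrix.kroneckerMap_apply]
  refine ⟨hd.mul_const _, R * ‖(1 : Matrix c c ℂ) i.2 j.2‖, fun z h0 h1 => ?_⟩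
  rw [norm_mul]
  gcongr
  exact hR z h0 h1

theorem EntireBddOnStrip.spectralMap [DecidableEq a] {A : Matrix a a ℂ} (hA : A.IsHermitian)
    (s t : ℝ) : EntireBddOnStrip fun z => spectralMap A (realCpow (s * z + t)) := by
  simp only [spectralMap_eq hA]
  refine ((EntireBddOnStrip.const _).mul ?_).mul (EntireBddOnStrip.const _)
  intro i j
  rcases eq_or_ne i j with rfl | hij
  · simp only [Matrix.diagonal_apply_eq]
    refine ⟨(differentiable_realCpow _).comp (by fun_prop),
      Real.exp ((|s| + |t|) * |Real.log (hA.eigenvalues i)|), fun z h0 h1 => norm_realCpow_le ?_ _⟩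
    simp only [Complex.add_re, Complex.mul_re, Complex.ofReal_re, Complex.ofReal_im, zero_mul,
      sub_zero]
    refine (abs_add_le _ _).trans ?_
    rw [abs_mul, abs_of_nonneg h0]
    gcongr
    exact mul_le_of_le_one_right (abs_nonneg _) h1
  · simp only [Matrix.diagonal_apply_ne _ hij]
    exact ⟨differentiable_const _, 0, by simp⟩

theorem EntireBddOnStrip.polarPow [DecidableEq a] (C : Matrix a a ℂ) (s t : ℝ) :
    EntireBddOnStrip fun z => polarPow C (s * z + t) := by
  have h : ∀ z : ℂ, (s * z + t - 1) / 2 = ((s / 2 : ℝ) : ℂ) * z + ((t - 1) / 2 : ℝ) := by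
    intro z; push_cast; ring
  simp only [_root_.polarPow, h]
  exact (EntireBddOnStrip.const _).mul
    (EntireBddOnStrip.spectralMap (Matrix.isHermitian_conjTranspose_mul_self C) _ _)

theorem EntireBddOnStrip.conjTranspose_polarPow_star [DecidableEq a] (C : Matrix a a ℂ) (s t : ℝ) :
    EntireBddOnStrip fun z => (_root_.polarPow C (star (s * z + t)))ᴴ := by
  have h : ∀ z : ℂ, (s * z + t - 1) / 2 = ((s / 2 : ℝ) : ℂ) * z + ((t - 1) / 2 : ℝ) := by
    intro z; push_cast; ring
  simp only [_root_.conjTranspose_polarPow_star, h]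
  exact (EntireBddOnStrip.spectralMap (Matrix.isHermitian_conjTranspose_mul_self C) _ _).mul
    (EntireBddOnStrip.const _)

theorem EntireBddOnStrip.norm_trace_le {f : ℂ → Matrix a a ℂ} (hf : EntireBddOnStrip f) {x y : ℝ}
    (h0 : ∀ z : ℂ, z.re = 0 → ‖(f z).trace‖ ≤ x) (h1 : ∀ z : ℂ, z.re = 1 → ‖(f z).trace‖ ≤ y)
    {θ : ℝ} (hθ0 : 0 ≤ θ) (hθ1 : θ ≤ 1) : ‖(f θ).trace‖ ≤ x ^ (1 - θ) * y ^ θ := by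
  choose hd F hF using hf
  have key := Complex.HadamardThreeLines.norm_le_interp_of_mem_verticalClosedStrip₀₁'
    (fun z => (f z).trace) (z := (θ : ℂ)) (a := x) (b := y) ⟨by simpa, by simpa⟩
    (Differentiable.diffContOnCl (Differentiable.fun_sum fun i _ => hd i i)) ?_
    (fun z hz => h0 z hz) (fun z hz => h1 z hz)
  · simpa using key
  · refine ⟨∑ i, F i i, ?_⟩
    rintro _ ⟨z, ⟨hz0, hz1⟩, rfl⟩
    exact (norm_sum_le _ _).trans (Finset.sum_le_sum fun i _ => hF i i z hz0 hz1)

end Strip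

/-! ### The interpolation estimate -/

section Interpolation

variable {κ k l : Type*} [Fintype κ] [DecidableEq κ] [Fintype k] [DecidableEq k] [Fintype l]
  [DecidableEq l]

omit [DecidableEq k] in
theorem trace_mul_kronecker_one (S : Matrix (k × l) (k × l) ℂ) (G : Matrix k k ℂ) :
    (S * (G ⊗ₖ (1 : Matrix l l ℂ))).trace = (ptrace2 S * G).trace := by
  simp only [Matrix.trace, Matrix.diag_apply, Matrix.mul_apply, Fintype.sum_prod_type, ptrace2,
    Matrix.kroneckerMap_apply, Matrix.one_apply, mul_ite, mul_one, mul_zero,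
    Finset.sum_ite_eq', Finset.mem_univ, if_true, Finset.sum_mul]
  refine Finset.sum_congr rfl fun i _ => ?_
  rw [Finset.sum_comm]

theorem hsSq_polarPow_kronecker_mul {B : Matrix (k × l) (k × l) ℂ} (hB : B.PosSemidef)
    (C : Matrix k k ℂ) {p : ℝ} (hp : 0 < p) {v w : ℂ} (hv : v.re = p / 2) (hw : w.re = p) :
    hsSq ((polarPow C w ⊗ₖ (1 : Matrix l l ℂ)) * spectralMap B (realCpow v)) =
      (ptrace2 (mrpow B p) * mrpow (Cᴴ * C) p).trace.re := by
  have hC := Matrix.posSemidef_conjTranspose_mul_self C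
  have h1 : (spectralMap B (realCpow v)) * (spectralMap B (realCpow v))ᴴ = mrpow B p := by
    rw [spectralMap_conjTranspose hB.isHermitian, spectralMap_mul hB.isHermitian,
      mrpow_eq_spectralMap hB.isHermitian]
    refine spectralMap_congr_of_posSemidef hB fun x hx => ?_
    rw [star_realCpow, ← realCpow_add, ← realCpow_ofReal hp.ne' hx]
    congr 1
    apply Complex.ext <;> simp [hv]
  have h2 : (polarPow C w)ᴴ * polarPow C w = mrpow (Cᴴ * C) p := by
    rw [conjTranspose_polarPow_mul_self, hw, mrpow_eq_spectralMap hC.isHermitian]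
    exact spectralMap_congr_of_posSemidef hC fun x hx => realCpow_ofReal hp.ne' hx
  rw [← trace_mul_kronecker_one, ← h1, ← h2, hsSq, Matrix.conjTranspose_mul,
    Matrix.conjTranspose_kronecker, Matrix.conjTranspose_one, Matrix.mul_assoc,
    Matrix.trace_mul_comm, ← Matrix.mul_assoc (_ ⊗ₖ _), ← Matrix.mul_kronecker_mul,
    Matrix.one_mul, Matrix.mul_assoc, Matrix.trace_mul_comm (_ ⊗ₖ _)]

/-- The analytic family used to interpolate between the contractive case and the Hilbert–Schmidt
case. -/
noncomputable def interpFamily (B : Matrix (k × l) (k × l) ℂ) (M : Matrix κ κ ℂ)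
    (J₀ J₁ : Matrix (k × l) κ ℂ) (C D : Matrix k k ℂ) (p : ℝ) (z : ℂ) : Matrix κ κ ℂ :=
  (polarPow M (star (p * (1 - z))))ᴴ *
    (J₀ᴴ * ((polarPow C (p * z) ⊗ₖ (1 : Matrix l l ℂ)) * spectralMap B (realCpow (p * z)) *
      ((polarPow Dᴴ (star (p * z)))ᴴ ⊗ₖ (1 : Matrix l l ℂ))) * J₁)

theorem norm_trace_interpFamily_le_of_re_eq_zero {B : Matrix (k × l) (k × l) ℂ} (hB : B.PosSemidef)
    (M : Matrix κ κ ℂ) {J₀ J₁ : Matrix (k × l) κ ℂ} (hJ₀ : IsContraction J₀)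
    (hJ₁ : IsContraction J₁) (C D : Matrix k k ℂ) {p : ℝ} (hp0 : 0 < p) {z : ℂ}
    (hz : z.re = 0) :
    ‖(interpFamily B M J₀ J₁ C D p z).trace‖ ≤ (mrpow (Mᴴ * M) (p / 2)).trace.re := by
  have hM := Matrix.posSemidef_conjTranspose_mul_self M
  have hz' : ((p : ℂ) * z).re = 0 := by simp [hz]
  set H := spectralMap (Mᴴ * M) (realCpow ((p / 4 : ℝ) : ℂ)) with hH
  have hHH : H * H = mrpow (Mᴴ * M) (p / 2) := by
    rw [hH, spectralMap_mul hM.isHermitian, mrpow_eq_spectralMap hM.isHermitian]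
    refine spectralMap_congr_of_posSemidef hM fun x hx => ?_
    rw [← realCpow_add, ← realCpow_ofReal (by positivity) hx]
    push_cast
    ring_nf
  have hHs : Hᴴ = H := by
    rw [hH, spectralMap_conjTranspose hM.isHermitian]
    simp only [star_realCpow, Complex.star_def, Complex.conj_ofReal]
  have hHp : spectralMap (Mᴴ * M) (realCpow ((p : ℂ) / 2)) = H * H := by
    rw [hHH, mrpow_eq_spectralMap hM.isHermitian]
    refine spectralMap_congr_of_posSemidef hM fun x hx => ?_
    rw [← realCpow_ofReal (by positivity) hx]
    push_cast
    rfl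
  set P := (polarPow M (star (-(p * z))))ᴴ with hP
  have hPc : IsContraction P := (isContraction_polarPow M (by
    simp only [Complex.star_def, Complex.conj_re, Complex.neg_re, hz', neg_zero])).conjTranspose
  have hW : (polarPow M (star (p * (1 - z))))ᴴ = H * H * P := by
    have e : star ((p : ℂ) * (1 - z)) = star (-(p * z)) + p := by
      simp only [mul_sub, mul_one, Complex.star_def, map_sub, map_neg, Complex.conj_ofReal]
      ring
    rw [e, polarPow_add, Matrix.conjTranspose_mul, hHp, Matrix.conjTranspose_mul, hHs]
  set K := J₀ᴴ * ((polarPow C (p * z) ⊗ₖ (1 : Matrix l l ℂ)) * spectralMap B (realCpow (p * z)) *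
      ((polarPow Dᴴ (star (p * z)))ᴴ ⊗ₖ (1 : Matrix l l ℂ))) * J₁ with hK
  have hKc : IsContraction K := by
    refine (hJ₀.conjTranspose.mul (IsContraction.mul (IsContraction.mul ?_ ?_) ?_)).mul hJ₁
    · exact (isContraction_polarPow C hz').kronecker_one
    · exact isContraction_spectralMap_realCpow hB.isHermitian hz'
    · exact (isContraction_polarPow Dᴴ (by
        simp only [Complex.star_def, Complex.conj_re, hz'])).conjTranspose.kronecker_one
  have hFz : interpFamily B M J₀ J₁ C D p z = H * H * P * K := by
    rw [← hW, interpFamily]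
  have hcyc : (H * H * P * K).trace = (H * (P * K * H)).trace := by
    rw [Matrix.mul_assoc, Matrix.mul_assoc, Matrix.trace_mul_comm, Matrix.mul_assoc,
      Matrix.mul_assoc]
  have hHn : hsSq H = (mrpow (Mᴴ * M) (p / 2)).trace.re := by rw [hsSq, hHs, hHH]
  rw [hFz, hcyc, ← hHn]
  calc _ ≤ Real.sqrt (hsSq H) * Real.sqrt (hsSq (P * K * H)) := norm_trace_mul_le _ _
    _ ≤ Real.sqrt (hsSq H) * Real.sqrt (hsSq H) := by
      gcongr
      exact (hPc.mul hKc).hsSq_mul_le H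
    _ = hsSq H := Real.mul_self_sqrt (hsSq_nonneg H)

theorem norm_trace_interpFamily_le_of_re_eq_one {B : Matrix (k × l) (k × l) ℂ} (hB : B.PosSemidef)
    (M : Matrix κ κ ℂ) {J₀ J₁ : Matrix (k × l) κ ℂ} (hJ₀ : IsContraction J₀)
    (hJ₁ : IsContraction J₁) (C D : Matrix k k ℂ) {p : ℝ} (hp0 : 0 < p) {z : ℂ}
    (hz : z.re = 1) :
    ‖(interpFamily B M J₀ J₁ C D p z).trace‖ ≤
      Real.sqrt (ptrace2 (mrpow B p) * mrpow (Cᴴ * C) p).trace.re *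
        Real.sqrt (ptrace2 (mrpow B p) * mrpow (D * Dᴴ) p).trace.re := by
  have hz' : ((p : ℂ) * z).re = p := by simp [hz]
  set P := (polarPow M (star (p * (1 - z))))ᴴ with hP
  have hPc : IsContraction P := (isContraction_polarPow M (by
    simp [hz])).conjTranspose
  set X := (polarPow C (p * z) ⊗ₖ (1 : Matrix l l ℂ)) * spectralMap B (realCpow ((p / 2 : ℝ) : ℂ))
    with hX
  set Z := spectralMap B (realCpow (p * z - (p / 2 : ℝ))) *
    ((polarPow Dᴴ (star (p * z)))ᴴ ⊗ₖ (1 : Matrix l l ℂ)) with hZ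
  have hXn : hsSq X = (ptrace2 (mrpow B p) * mrpow (Cᴴ * C) p).trace.re :=
    hsSq_polarPow_kronecker_mul hB C hp0 (by simp) hz'
  have hZn : hsSq Zᴴ = (ptrace2 (mrpow B p) * mrpow (D * Dᴴ) p).trace.re := by
    have h := hsSq_polarPow_kronecker_mul (l := l) hB Dᴴ hp0
      (v := star (p * z - (p / 2 : ℝ))) (w := star (p * z))
      (by rw [Complex.star_def, Complex.conj_re, Complex.sub_re, hz', Complex.ofReal_re]; ring)
      (by rw [Complex.star_def, Complex.conj_re, hz'])
    rw [Matrix.conjTranspose_conjTranspose] at h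
    rw [← h, hZ, Matrix.conjTranspose_mul, spectralMap_conjTranspose hB.isHermitian,
      Matrix.conjTranspose_kronecker, Matrix.conjTranspose_conjTranspose,
      Matrix.conjTranspose_one]
    simp only [star_realCpow]
  have hBs : spectralMap B (realCpow (p * z)) =
      spectralMap B (realCpow ((p / 2 : ℝ) : ℂ)) *
        spectralMap B (realCpow (p * z - (p / 2 : ℝ))) := by
    rw [spectralMap_mul hB.isHermitian]
    simp only [← realCpow_add]
    congr 2
    ring
  have hFz : interpFamily B M J₀ J₁ C D p z = (P * J₀ᴴ * X) * (Z * J₁) := by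
    simp only [interpFamily, hBs, hX, hZ, hP, Matrix.mul_assoc]
  rw [hFz, ← hXn, ← hZn]
  refine (norm_trace_mul_le _ _).trans ?_
  refine mul_le_mul (Real.sqrt_le_sqrt ?_) (Real.sqrt_le_sqrt ?_) (Real.sqrt_nonneg _)
    (Real.sqrt_nonneg _)
  · exact (hPc.mul hJ₀.conjTranspose).hsSq_mul_le X
  · rw [← hsSq_conjTranspose, Matrix.conjTranspose_mul]
    exact hJ₁.conjTranspose.hsSq_mul_le Zᴴ

/-- Interpolation bound, between the contractive case and the Hilbert–Schmidt case, for the dual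
pairing of a matrix with a compression of `(C ⊗ 1) B (D ⊗ 1)`, `B ≥ 0`. -/
theorem norm_trace_polarPow_mul_le {B : Matrix (k × l) (k × l) ℂ} (hB : B.PosSemidef)
    (M : Matrix κ κ ℂ) {J₀ J₁ : Matrix (k × l) κ ℂ} (hJ₀ : IsContraction J₀)
    (hJ₁ : IsContraction J₁) (C D : Matrix k k ℂ) {p : ℝ} (hp : 1 ≤ p) :
    ‖((polarPow M ((p : ℂ) - 1))ᴴ *
      (J₀ᴴ * ((C ⊗ₖ (1 : Matrix l l ℂ)) * B * (D ⊗ₖ (1 : Matrix l l ℂ))) * J₁)).trace‖ ≤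
    (mrpow (Mᴴ * M) (p / 2)).trace.re ^ (1 - 1 / p) *
      (Real.sqrt (ptrace2 (mrpow B p) * mrpow (Cᴴ * C) p).trace.re *
        Real.sqrt (ptrace2 (mrpow B p) * mrpow (D * Dᴴ) p).trace.re) ^ (1 / p) := by
  have hp0 : 0 < p := by linarith
  have hpc : (p : ℂ) ≠ 0 := by exact_mod_cast hp0.ne'
  let F := interpFamily B M J₀ J₁ C D p
  have hF : EntireBddOnStrip F := by
    have h1 : EntireBddOnStrip fun z : ℂ => (polarPow M (star (p * (1 - z))))ᴴ := by
      have e : ∀ z : ℂ, (p : ℂ) * (1 - z) = ((-p : ℝ) : ℂ) * z + (p : ℝ) := by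
        intro z; push_cast; ring
      simp only [e]
      exact .conjTranspose_polarPow_star M _ _
    have e : ∀ z : ℂ, (p : ℂ) * z = (p : ℂ) * z + (0 : ℝ) := by
      intro z; simp
    have h2 : EntireBddOnStrip fun z : ℂ => polarPow C (p * z) ⊗ₖ (1 : Matrix l l ℂ) := by
      have := EntireBddOnStrip.polarPow C p 0
      simp only [← e] at this
      exact this.kronecker_one
    have h3 : EntireBddOnStrip fun z : ℂ => spectralMap B (realCpow (p * z)) := by
      have := EntireBddOnStrip.spectralMap hB.isHermitian p 0
      simpa only [← e] using this
    have h4 : EntireBddOnStrip fun z : ℂ =>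
        (polarPow Dᴴ (star (p * z)))ᴴ ⊗ₖ (1 : Matrix l l ℂ) := by
      have := EntireBddOnStrip.conjTranspose_polarPow_star Dᴴ p 0
      simp only [← e] at this
      exact this.kronecker_one
    simp only [F]
    exact h1.mul (((EntireBddOnStrip.const _).mul ((h2.mul h3).mul h4)).mul (.const _))
  have hθ : F ((1 / p : ℝ) : ℂ) = (polarPow M ((p : ℂ) - 1))ᴴ *
      (J₀ᴴ * ((C ⊗ₖ (1 : Matrix l l ℂ)) * B * (D ⊗ₖ (1 : Matrix l l ℂ))) * J₁) := by
    have e1 : (p : ℂ) * (1 - ((1 / p : ℝ) : ℂ)) = p - 1 := by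
      push_cast; field_simp
    have e2 : (p : ℂ) * ((1 / p : ℝ) : ℂ) = 1 := by
      push_cast; field_simp
    have e3 : spectralMap B (realCpow 1) = B := by
      conv_rhs => rw [← spectralMap_id hB.isHermitian]
      exact spectralMap_congr_of_posSemidef hB fun x hx => realCpow_one hx
    simp only [F, interpFamily, e1, e2, e3, star_one, polarPow_one, Matrix.conjTranspose_conjTranspose]
    simp
  rw [← hθ]
  refine hF.norm_trace_le
    (fun z hz => norm_trace_interpFamily_le_of_re_eq_zero hB M hJ₀ hJ₁ C D hp0 hz)
    (fun z hz => norm_trace_interpFamily_le_of_re_eq_one hB M hJ₀ hJ₁ C D hp0 hz) (by positivity) ((div_le_one hp0).2 hp)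

end Interpolation

/-! ### Schatten norms -/

section Schatten

variable {k : Type*} [Fintype k] [DecidableEq k]

theorem schattenNorm_ofReal (M : Matrix k k ℂ) {s : ℝ} (hs : 0 ≤ s) :
    schattenNorm (ENNReal.ofReal s) M = (mrpow (Mᴴ * M) (s / 2)).trace.re ^ (1 / s) := by
  rw [schattenNorm, if_neg ENNReal.ofReal_ne_top, ENNReal.toReal_ofReal hs,
    trace_mrpow (Matrix.posSemidef_conjTranspose_mul_self M).isHermitian]

theorem schattenNorm_nonneg (s : ℝ≥0∞) (M : Matrix k k ℂ) : 0 ≤ schattenNorm s M := by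
  unfold schattenNorm
  split_ifs
  · exact Real.iSup_nonneg fun i => Real.sqrt_nonneg _
  · exact Real.rpow_nonneg (Finset.sum_nonneg fun i _ => Real.rpow_nonneg
      ((Matrix.posSemidef_conjTranspose_mul_self M).eigenvalues_nonneg i) _) _

theorem schattenNorm_conjTranspose (s : ℝ≥0∞) (M : Matrix k k ℂ) :
    schattenNorm s Mᴴ = schattenNorm s M := by
  have h : (Matrix.posSemidef_conjTranspose_mul_self Mᴴ).isHermitian.eigenvalues =
      (Matrix.posSemidef_conjTranspose_mul_self M).isHermitian.eigenvalues := by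
    rw [Matrix.IsHermitian.eigenvalues_eq_eigenvalues_iff, Matrix.conjTranspose_conjTranspose,
      Matrix.charpoly_mul_comm]
  rw [schattenNorm, schattenNorm, h]

theorem Real.rpow_one_div_le_of_le_rpow_mul {T b p : ℝ} (hp : 1 ≤ p) (hT : 0 ≤ T) (hb : 0 ≤ b)
    (h : T ≤ T ^ (1 - 1 / p) * b) : T ^ (1 / p) ≤ b := by
  rcases hT.eq_or_lt with rfl | hT
  · rwa [Real.zero_rpow (by positivity)]
  · have h1 : T ^ (1 - 1 / p) * T ^ (1 / p) = T := by
      rw [← Real.rpow_add hT]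
      simp
    rw [← h1] at h
    nth_rw 2 [h1] at h
    exact le_of_mul_le_mul_left h (Real.rpow_pos_of_pos hT _)

theorem schattenNorm_le_of_norm_trace_polarPow_mul_le (M : Matrix k k ℂ) {p b : ℝ} (hp : 1 ≤ p)
    (hb : 0 ≤ b) (h : ‖((polarPow M ((p : ℂ) - 1))ᴴ * M).trace‖ ≤
      (mrpow (Mᴴ * M) (p / 2)).trace.re ^ (1 - 1 / p) * b) :
    schattenNorm (ENNReal.ofReal p) M ≤ b := by
  have hM := Matrix.posSemidef_conjTranspose_mul_self M
  have h1 : (polarPow M ((p : ℂ) - 1))ᴴ * M = mrpow (Mᴴ * M) (p / 2) := by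
    have h2 := conjTranspose_polarPow_star_mul M ((p : ℂ) - 1)
    have h3 : star ((p : ℂ) - 1) = (p : ℂ) - 1 := by simp
    rw [h3] at h2
    rw [h2, mrpow_eq_spectralMap hM.isHermitian]
    refine spectralMap_congr_of_posSemidef hM fun x hx => ?_
    rw [← realCpow_ofReal (by positivity) hx]
    push_cast
    ring_nf
  rw [schattenNorm_ofReal M (by linarith)]
  refine Real.rpow_one_div_le_of_le_rpow_mul hp (trace_mrpow_nonneg hM _) hb ?_
  rw [h1] at h
  exact (Complex.re_le_norm _).trans h

end Schatten

/-! ### Compressions to blocks -/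

section Blocks

variable {k l : Type*} [Fintype k] [DecidableEq k] [Fintype l] [DecidableEq l]

/-- The isometric embedding of `k × l` onto the `a`-th block of `k × (l × Fin 2)`. -/
noncomputable def blockEmb (k l : Type*) [DecidableEq k] [DecidableEq l] (a : Fin 2) :
    Matrix (k × (l × Fin 2)) (k × l) ℂ :=
  (1 : Matrix k k ℂ) ⊗ₖ Matrix.of fun (x : l × Fin 2) (y : l) => if x = (y, a) then (1 : ℂ) else 0

theorem isContraction_blockEmb (a : Fin 2) : IsContraction (blockEmb k l a) := by
  have h : (blockEmb k l a)ᴴ * blockEmb k l a = 1 := by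
    rw [blockEmb, Matrix.conjTranspose_kronecker, ← Matrix.mul_kronecker_mul,
      ← Matrix.one_kronecker_one, Matrix.conjTranspose_one, Matrix.one_mul]
    congr 1
    ext i j
    simp [Matrix.mul_apply, Matrix.one_apply, eq_comm]
  rw [IsContraction, h, sub_self]
  exact Matrix.PosSemidef.zero

theorem kronecker_one_mul_blockEmb (C : Matrix k k ℂ) (a : Fin 2) :
    (C ⊗ₖ (1 : Matrix (l × Fin 2) (l × Fin 2) ℂ)) * blockEmb k l a =
      blockEmb k l a * (C ⊗ₖ (1 : Matrix l l ℂ)) := by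
  simp only [blockEmb, ← Matrix.mul_kronecker_mul, Matrix.mul_one, Matrix.one_mul]

theorem blockEmb_conjTranspose_mul_kronecker_one (C : Matrix k k ℂ) (a : Fin 2) :
    (blockEmb k l a)ᴴ * (C ⊗ₖ (1 : Matrix (l × Fin 2) (l × Fin 2) ℂ)) =
      (C ⊗ₖ (1 : Matrix l l ℂ)) * (blockEmb k l a)ᴴ := by
  simp only [blockEmb, Matrix.conjTranspose_kronecker, Matrix.conjTranspose_one,
    ← Matrix.mul_kronecker_mul, Matrix.mul_one, Matrix.one_mul]

theorem blockEmb_compress_kronecker (C D : Matrix k k ℂ)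
    (X : Matrix (k × (l × Fin 2)) (k × (l × Fin 2)) ℂ) (a b : Fin 2) :
    (blockEmb k l a)ᴴ * ((C ⊗ₖ (1 : Matrix (l × Fin 2) (l × Fin 2) ℂ)) * X *
      (D ⊗ₖ (1 : Matrix (l × Fin 2) (l × Fin 2) ℂ))) * blockEmb k l b =
    (C ⊗ₖ (1 : Matrix l l ℂ)) * ((blockEmb k l a)ᴴ * X * blockEmb k l b) *
      (D ⊗ₖ (1 : Matrix l l ℂ)) := by
  simp only [Matrix.mul_assoc, kronecker_one_mul_blockEmb]
  simp only [← Matrix.mul_assoc, blockEmb_conjTranspose_mul_kronecker_one]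

theorem blockEmb_compress_clBlock (Y : Matrix (k × l) (k × l) ℂ) :
    (blockEmb k l 0)ᴴ * clBlock Y * blockEmb k l 1 = Y := by
  ext i j
  have h : ∀ x, (clBlock Y * blockEmb k l 1) x j = clBlock Y x (j.1, (j.2, 1)) := by
    intro x
    simp [Matrix.mul_apply, Fintype.sum_prod_type, blockEmb, Matrix.one_apply, ite_and,
      Prod.ext_iff]
  rw [Matrix.mul_assoc, Matrix.mul_apply]
  simp only [h]
  simp [Fintype.sum_prod_type, blockEmb, Matrix.one_apply, ite_and, Prod.ext_iff, clBlock,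
    apply_ite (starRingEnd ℂ)]

omit [Fintype k] [DecidableEq k] [Fintype l] [DecidableEq l] in
theorem clBlock_isHermitian (Y : Matrix (k × l) (k × l) ℂ) : (clBlock Y).IsHermitian := by
  ext ⟨i, i', a⟩ ⟨j, j', b⟩
  fin_cases a <;> fin_cases b <;> simp [clBlock]

omit [Fintype k] [DecidableEq k] [DecidableEq l] in
theorem ptrace2_posSemidef {S : Matrix (k × l) (k × l) ℂ} (hS : S.PosSemidef) :
    (ptrace2 S).PosSemidef := by
  have h : ptrace2 S = ∑ j : l, S.submatrix (fun i => (i, j)) (fun i => (i, j)) := by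
    ext i i'
    simp [ptrace2, Matrix.sum_apply]
  rw [h]
  exact Matrix.posSemidef_sum _ fun j _ => hS.submatrix _

theorem Psi_nonneg (p q : ℝ) {A : Matrix (k × l) (k × l) ℂ} (hA : A.PosSemidef) :
    0 ≤ Psi p q A :=
  Real.rpow_nonneg (trace_mrpow_nonneg (ptrace2_posSemidef (mrpow_posSemidef hA p)) _) _

end Blocks

/-! ### Trace inequalities -/

section TraceIneq

variable {k : Type*} [Fintype k] [DecidableEq k] {A G : Matrix k k ℂ}

/-- The doubly stochastic matrix of squared overlaps of two eigenbases. -/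
noncomputable def overlap (hA : A.IsHermitian) (hG : G.IsHermitian) (i j : k) : ℝ :=
  ‖(((hA.eigenvectorUnitary : Matrix k k ℂ))ᴴ * (hG.eigenvectorUnitary : Matrix k k ℂ)) i j‖ ^ 2

theorem sum_overlap_right (hA : A.IsHermitian) (hG : G.IsHermitian) (i : k) :
    ∑ j, overlap hA hG i j = 1 := by
  set W := ((hA.eigenvectorUnitary : Matrix k k ℂ))ᴴ * (hG.eigenvectorUnitary : Matrix k k ℂ)
    with hW
  have h : W * Wᴴ = 1 := by
    rw [hW, Matrix.conjTranspose_mul, Matrix.conjTranspose_conjTranspose, Matrix.mul_assoc,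
      ← Matrix.mul_assoc (hG.eigenvectorUnitary : Matrix k k ℂ),
      eigenvectorUnitary_mul_conjTranspose_self, Matrix.one_mul,
      eigenvectorUnitary_conjTranspose_mul_self]
  have h2 := congrFun (congrFun h i) i
  rw [Matrix.mul_apply, Matrix.one_apply_eq] at h2
  have h3 := congrArg Complex.re h2
  rw [Complex.re_sum, Complex.one_re] at h3
  rw [← h3]
  refine Finset.sum_congr rfl fun j _ => ?_
  rw [Matrix.conjTranspose_apply, Complex.star_def, Complex.mul_conj, Complex.ofReal_re,
    Complex.normSq_eq_norm_sq]
  rfl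

theorem sum_overlap_left (hA : A.IsHermitian) (hG : G.IsHermitian) (j : k) :
    ∑ i, overlap hA hG i j = 1 := by
  rw [← sum_overlap_right hG hA j]
  refine Finset.sum_congr rfl fun i _ => ?_
  unfold overlap
  rw [← norm_star, ← Matrix.conjTranspose_apply, Matrix.conjTranspose_mul,
    Matrix.conjTranspose_conjTranspose]

theorem trace_mul_mrpow (hA : A.IsHermitian) (hG : G.IsHermitian) (e : ℝ) :
    (A * mrpow G e).trace.re =
      ∑ i, ∑ j, overlap hA hG i j * (hA.eigenvalues i * hG.eigenvalues j ^ e) := by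
  nth_rw 1 [← spectralMap_id hA]
  rw [mrpow_eq_spectralMap hG, spectralMap_eq hA, spectralMap_eq hG]
  set U := (hA.eigenvectorUnitary : Matrix k k ℂ) with hU
  set V := (hG.eigenvectorUnitary : Matrix k k ℂ) with hV
  set a := Matrix.diagonal fun i => (hA.eigenvalues i : ℂ)
  set g := Matrix.diagonal fun i => ((hG.eigenvalues i ^ e : ℝ) : ℂ)
  have h : (U * a * Uᴴ * (V * g * Vᴴ)).trace = (a * (Uᴴ * V) * (g * (Uᴴ * V)ᴴ)).trace := by
    rw [Matrix.conjTranspose_mul, Matrix.conjTranspose_conjTranspose]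
    simp only [Matrix.mul_assoc]
    rw [Matrix.trace_mul_comm]
    simp only [Matrix.mul_assoc]
  rw [h, Matrix.trace, Complex.re_sum]
  refine Finset.sum_congr rfl fun i _ => ?_
  rw [Matrix.diag_apply, Matrix.mul_apply, Complex.re_sum]
  refine Finset.sum_congr rfl fun j _ => ?_
  rw [Matrix.diagonal_mul, Matrix.diagonal_mul, Matrix.conjTranspose_apply, Complex.star_def,
    mul_mul_mul_comm, Complex.mul_conj, ← Complex.ofReal_mul, ← Complex.ofReal_mul,
    Complex.ofReal_re, Complex.normSq_eq_norm_sq, mul_comm]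
  rfl

theorem trace_mul_mrpow_le_of_le (hA : A.PosSemidef) (hG : G.PosSemidef) (e : ℝ) {b : ℝ}
    (hb : ∀ j, hG.isHermitian.eigenvalues j ^ e ≤ b) :
    (A * mrpow G e).trace.re ≤ (mrpow A 1).trace.re * b := by
  rw [trace_mul_mrpow hA.isHermitian hG.isHermitian, trace_mrpow hA.isHermitian, Finset.sum_mul]
  refine Finset.sum_le_sum fun i _ => ?_
  rw [Real.rpow_one]
  calc _ ≤ ∑ j, overlap hA.isHermitian hG.isHermitian i j * (hA.isHermitian.eigenvalues i * b) := by
        refine Finset.sum_le_sum fun j _ => ?_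
        exact mul_le_mul_of_nonneg_left (mul_le_mul_of_nonneg_left (hb j) (hA.eigenvalues_nonneg i))
          (sq_nonneg _)
    _ = _ := by rw [← Finset.sum_mul, sum_overlap_right, one_mul]

/-- Hölder's inequality for the trace of a product of positive semidefinite matrices. -/
theorem trace_mul_mrpow_le (hA : A.PosSemidef) (hG : G.PosSemidef) (e : ℝ) {a b : ℝ}
    (hab : a.HolderConjugate b) :
    (A * mrpow G e).trace.re ≤
      (mrpow A a).trace.re ^ (1 / a) * (mrpow G (e * b)).trace.re ^ (1 / b) := by
  rw [trace_mul_mrpow hA.isHermitian hG.isHermitian, trace_mrpow hA.isHermitian,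
    trace_mrpow hG.isHermitian, ← Fintype.sum_prod_type']
  set w := overlap hA.isHermitian hG.isHermitian
  have hw : ∀ i j, 0 ≤ w i j := fun i j => sq_nonneg _
  set x := hA.isHermitian.eigenvalues
  set y := hG.isHermitian.eigenvalues
  have hx : ∀ i, 0 ≤ x i := hA.eigenvalues_nonneg
  have hy : ∀ i, 0 ≤ y i := hG.eigenvalues_nonneg
  have key := Real.inner_le_Lp_mul_Lq_of_nonneg Finset.univ hab
    (f := fun z : k × k => w z.1 z.2 ^ (1 / a) * x z.1)
    (g := fun z : k × k => w z.1 z.2 ^ (1 / b) * y z.2 ^ e)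
    (fun z _ => mul_nonneg (Real.rpow_nonneg (hw _ _) _) (hx _))
    (fun z _ => mul_nonneg (Real.rpow_nonneg (hw _ _) _) (Real.rpow_nonneg (hy _) _))
  have ha := hab.pos
  have hb := hab.symm.pos
  have h1 : ∀ z : k × k, (w z.1 z.2 ^ (1 / a) * x z.1) ^ a = w z.1 z.2 * x z.1 ^ a := by
    intro z
    rw [Real.mul_rpow (Real.rpow_nonneg (hw _ _) _) (hx _), ← Real.rpow_mul (hw _ _),
      one_div_mul_cancel ha.ne', Real.rpow_one]
  have h2 : ∀ z : k × k, (w z.1 z.2 ^ (1 / b) * y z.2 ^ e) ^ b = w z.1 z.2 * y z.2 ^ (e * b) := by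
    intro z
    rw [Real.mul_rpow (Real.rpow_nonneg (hw _ _) _) (Real.rpow_nonneg (hy _) _),
      ← Real.rpow_mul (hw _ _), one_div_mul_cancel hb.ne', Real.rpow_one, Real.rpow_mul (hy _)]
  have h3 : ∀ z : k × k, (w z.1 z.2 ^ (1 / a) * x z.1) * (w z.1 z.2 ^ (1 / b) * y z.2 ^ e) =
      w z.1 z.2 * (x z.1 * y z.2 ^ e) := by
    intro z
    rw [mul_mul_mul_comm, ← Real.rpow_add_of_nonneg (hw _ _) (by positivity) (by positivity),
      one_div, one_div, hab.inv_add_inv_eq_one, Real.rpow_one]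
  simp only [h1, h2, h3] at key
  refine key.trans_eq ?_
  congr 2
  · rw [Fintype.sum_prod_type]
    simp only [← Finset.sum_mul, w, sum_overlap_right, one_mul]
  · rw [Fintype.sum_prod_type_right]
    simp only [← Finset.sum_mul, w, sum_overlap_left, one_mul]

end TraceIneq

/-! ### Compression bounds in terms of `Psi` -/

section Compression

variable {κ k l : Type*} [Fintype κ] [DecidableEq κ] [Fintype k] [DecidableEq k] [Fintype l]
  [DecidableEq l]

/-- The bound for the Schatten `p`-norm of compressions of `(C ⊗ 1) B (D ⊗ 1)` obtained by
interpolation. -/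
noncomputable def interpBound (p : ℝ) (B : Matrix (k × l) (k × l) ℂ) (C D : Matrix k k ℂ) : ℝ :=
  (Real.sqrt (ptrace2 (mrpow B p) * mrpow (Cᴴ * C) p).trace.re *
    Real.sqrt (ptrace2 (mrpow B p) * mrpow (D * Dᴴ) p).trace.re) ^ (1 / p)

theorem interpBound_nonneg (p : ℝ) (B : Matrix (k × l) (k × l) ℂ) (C D : Matrix k k ℂ) :
    0 ≤ interpBound p B C D :=
  Real.rpow_nonneg (mul_nonneg (Real.sqrt_nonneg _) (Real.sqrt_nonneg _)) _

theorem schattenNorm_compress_le {B : Matrix (k × l) (k × l) ℂ} (hB : B.PosSemidef)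
    {J₀ J₁ : Matrix (k × l) κ ℂ} (hJ₀ : IsContraction J₀) (hJ₁ : IsContraction J₁)
    (C D : Matrix k k ℂ) {p : ℝ} (hp : 1 ≤ p) :
    schattenNorm (ENNReal.ofReal p)
      (J₀ᴴ * ((C ⊗ₖ (1 : Matrix l l ℂ)) * B * (D ⊗ₖ (1 : Matrix l l ℂ))) * J₁) ≤
      interpBound p B C D :=
  schattenNorm_le_of_norm_trace_polarPow_mul_le _ hp (interpBound_nonneg p B C D)
    (norm_trace_polarPow_mul_le hB _ hJ₀ hJ₁ C D hp)

theorem schattenNorm_compress_sub_le {A B : Matrix (k × l) (k × l) ℂ} (hA : A.PosSemidef)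
    (hB : B.PosSemidef) {J₀ J₁ : Matrix (k × l) κ ℂ} (hJ₀ : IsContraction J₀)
    (hJ₁ : IsContraction J₁) (C D : Matrix k k ℂ) {p : ℝ} (hp : 1 ≤ p) :
    schattenNorm (ENNReal.ofReal p)
      (J₀ᴴ * ((C ⊗ₖ (1 : Matrix l l ℂ)) * B * (D ⊗ₖ (1 : Matrix l l ℂ))) * J₁ -
        J₀ᴴ * ((C ⊗ₖ (1 : Matrix l l ℂ)) * A * (D ⊗ₖ (1 : Matrix l l ℂ))) * J₁) ≤
      interpBound p B C D + interpBound p A C D := by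
  set X := J₀ᴴ * ((C ⊗ₖ (1 : Matrix l l ℂ)) * B * (D ⊗ₖ (1 : Matrix l l ℂ))) * J₁ with hX
  set Z := J₀ᴴ * ((C ⊗ₖ (1 : Matrix l l ℂ)) * A * (D ⊗ₖ (1 : Matrix l l ℂ))) * J₁ with hZ
  refine schattenNorm_le_of_norm_trace_polarPow_mul_le _ hp
    (add_nonneg (interpBound_nonneg p B C D) (interpBound_nonneg p A C D)) ?_
  rw [Matrix.mul_sub, Matrix.trace_sub, mul_add]
  refine (norm_sub_le _ _).trans (add_le_add ?_ ?_)
  · exact norm_trace_polarPow_mul_le hB (X - Z) hJ₀ hJ₁ C D hp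
  · exact norm_trace_polarPow_mul_le hA (X - Z) hJ₀ hJ₁ C D hp

end Compression

/-! ### The exponent `ncR` -/

theorem ncR_comm (p q : ℝ≥0∞) : ncR p q = ncR q p := by
  rw [ncR, ncR, max_comm, min_comm]

theorem two_mul_ncR_self (p : ℝ≥0∞) : 2 * ncR p p = ⊤ := by
  simp [ncR]

theorem two_mul_ncR_ofReal {p q : ℝ} (hp : 0 < p) (hpq : p < q) :
    2 * ncR (ENNReal.ofReal p) (ENNReal.ofReal q) = ENNReal.ofReal (2 * (p * q / (q - p))) := by
  have hq : 0 < q := hp.trans hpq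
  have h1 : q⁻¹ < p⁻¹ := (inv_lt_inv₀ hq hp).2 hpq
  have h2 : (p⁻¹ - q⁻¹)⁻¹ = p * q / (q - p) := by
    have : q - p ≠ 0 := by linarith
    field_simp
  rw [ncR, ← ENNReal.ofReal_inv_of_pos hp, ← ENNReal.ofReal_inv_of_pos hq,
    max_eq_left (ENNReal.ofReal_le_ofReal h1.le), min_eq_right (ENNReal.ofReal_le_ofReal h1.le),
    ← ENNReal.ofReal_sub _ (inv_nonneg.2 hq.le), ← ENNReal.ofReal_inv_of_pos (by linarith), h2,
    ENNReal.ofReal_mul zero_le_two]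
  simp

/-! ### The case `p ≤ q` -/

section Sup

variable {k l : Type*} [Fintype k] [DecidableEq k] [Fintype l] [DecidableEq l]

theorem trace_mul_mrpow_le_schattenNorm {A : Matrix k k ℂ} (hA : A.PosSemidef) (C : Matrix k k ℂ)
    {p q : ℝ} (hp : 0 < p) (hpq : p ≤ q) :
    (A * mrpow (Cᴴ * C) p).trace.re ≤ ((mrpow A (q / p)).trace.re ^ (1 / q)) ^ p *
      schattenNorm (2 * ncR (ENNReal.ofReal p) (ENNReal.ofReal q)) C ^ (2 * p) := by
  have hC := Matrix.posSemidef_conjTranspose_mul_self C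
  have hq : 0 < q := hp.trans_le hpq
  have hTA : ∀ e, 0 ≤ (mrpow A e).trace.re := trace_mrpow_nonneg hA
  have hTC : ∀ e, 0 ≤ (mrpow (Cᴴ * C) e).trace.re := trace_mrpow_nonneg hC
  rcases hpq.eq_or_lt with rfl | hlt
  · rw [two_mul_ncR_self, div_self hp.ne', ← Real.rpow_mul (hTA _), one_div_mul_cancel hp.ne',
      Real.rpow_one]
    refine trace_mul_mrpow_le_of_le hA hC p fun j => ?_
    have h0 := hC.eigenvalues_nonneg j
    rw [schattenNorm, if_pos rfl]
    calc hC.isHermitian.eigenvalues j ^ p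
        = Real.sqrt (hC.isHermitian.eigenvalues j) ^ (2 * p) := by
          rw [Real.sqrt_eq_rpow, ← Real.rpow_mul h0]
          congr 1
          ring
      _ ≤ _ := Real.rpow_le_rpow (Real.sqrt_nonneg _)
          (le_ciSup (Set.finite_range fun i => Real.sqrt (hC.isHermitian.eigenvalues i)).bddAbove j)
          (by positivity)
  · have hd : 0 < q - p := sub_pos.2 hlt
    have hab : (q / p).HolderConjugate (q / (q - p)) := by
      rw [Real.holderConjugate_iff]
      refine ⟨(one_lt_div hp).2 hlt, ?_⟩
      field_simp
      ring
    have h := trace_mul_mrpow_le hA hC p hab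
    refine h.trans_eq ?_
    rw [two_mul_ncR_ofReal hp hlt, schattenNorm_ofReal C (by positivity),
      ← Real.rpow_mul (hTA _), ← Real.rpow_mul (hTC _)]
    congr 2
    · field_simp
    · congr 3
      field_simp
    · field_simp

theorem sqrt_mul_sqrt_rpow_one_div {p x c d : ℝ} (hp : 0 < p) (hx : 0 ≤ x) (hc : 0 ≤ c)
    (hd : 0 ≤ d) :
    (Real.sqrt (x ^ p * c ^ (2 * p)) * Real.sqrt (x ^ p * d ^ (2 * p))) ^ (1 / p) =
      x * (c * d) := by
  have h2 : ∀ y : ℝ, 0 ≤ y → y ^ (2 * p) = y ^ p * y ^ p := fun y hy => by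
    rw [two_mul, Real.rpow_add_of_nonneg hy hp.le hp.le]
  have h1 : (x * (c * d)) ^ p * (x * (c * d)) ^ p =
      x ^ p * c ^ (2 * p) * (x ^ p * d ^ (2 * p)) := by
    rw [h2 c hc, h2 d hd, Real.mul_rpow hx (mul_nonneg hc hd), Real.mul_rpow hc hd]
    ring
  have h0 : 0 ≤ x * (c * d) := mul_nonneg hx (mul_nonneg hc hd)
  rw [← Real.sqrt_mul (mul_nonneg (Real.rpow_nonneg hx _) (Real.rpow_nonneg hc _)), ← h1,
    Real.sqrt_mul_self (Real.rpow_nonneg h0 _), ← Real.rpow_mul h0, mul_one_div_cancel hp.ne',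
    Real.rpow_one]

theorem interpBound_le {B : Matrix (k × l) (k × l) ℂ} (hB : B.PosSemidef) (C D : Matrix k k ℂ)
    {p q : ℝ} (hp : 0 < p) (hpq : p ≤ q) :
    interpBound p B C D ≤ Psi p q B *
      (schattenNorm (2 * ncR (ENNReal.ofReal p) (ENNReal.ofReal q)) C *
        schattenNorm (2 * ncR (ENNReal.ofReal p) (ENNReal.ofReal q)) D) := by
  have hσ := ptrace2_posSemidef (mrpow_posSemidef hB p)
  have hC := trace_mul_mrpow_le_schattenNorm hσ C hp hpq
  have hD := trace_mul_mrpow_le_schattenNorm hσ Dᴴ hp hpq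
  rw [Matrix.conjTranspose_conjTranspose, schattenNorm_conjTranspose] at hD
  change _ ≤ Psi p q B ^ p * _ at hC
  change _ ≤ Psi p q B ^ p * _ at hD
  have hψ := Psi_nonneg p q hB
  rw [← sqrt_mul_sqrt_rpow_one_div hp hψ (schattenNorm_nonneg _ C) (schattenNorm_nonneg _ D)]
  exact Real.rpow_le_rpow (mul_nonneg (Real.sqrt_nonneg _) (Real.sqrt_nonneg _))
    (mul_le_mul (Real.sqrt_le_sqrt hC) (Real.sqrt_le_sqrt hD) (Real.sqrt_nonneg _)
      (Real.sqrt_nonneg _)) (by positivity)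

theorem eq_compress_sub_compress {A B : Matrix (k × (l × Fin 2)) (k × (l × Fin 2)) ℂ}
    {Y : Matrix (k × l) (k × l) ℂ} (h : clBlock Y + A = B) :
    Y = (blockEmb k l 0)ᴴ * B * blockEmb k l 1 - (blockEmb k l 0)ᴴ * A * blockEmb k l 1 := by
  rw [← h, Matrix.mul_add, Matrix.add_mul, add_sub_cancel_right, blockEmb_compress_clBlock]

theorem ncNormSup_le {A B : Matrix (k × (l × Fin 2)) (k × (l × Fin 2)) ℂ} (hA : A.PosSemidef)
    (hB : B.PosSemidef) {Y : Matrix (k × l) (k × l) ℂ} (h : clBlock Y + A = B) {p q : ℝ}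
    (hp : 1 ≤ p) (hpq : p ≤ q) :
    ncNormSup (ENNReal.ofReal p) (ENNReal.ofReal q) Y ≤ Psi p q A + Psi p q B := by
  have hp0 : 0 < p := by linarith
  have h0 : 0 ≤ Psi p q A + Psi p q B := add_nonneg (Psi_nonneg p q hA) (Psi_nonneg p q hB)
  refine Real.iSup_le (fun C => Real.iSup_le (fun D => ?_) h0) h0
  refine div_le_of_le_mul₀ (mul_nonneg (schattenNorm_nonneg _ _) (schattenNorm_nonneg _ _)) h0 ?_
  have h1 : (C ⊗ₖ (1 : Matrix l l ℂ)) * Y * (D ⊗ₖ (1 : Matrix l l ℂ)) =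
      (blockEmb k l 0)ᴴ * ((C ⊗ₖ (1 : Matrix (l × Fin 2) (l × Fin 2) ℂ)) * B *
        (D ⊗ₖ (1 : Matrix (l × Fin 2) (l × Fin 2) ℂ))) * blockEmb k l 1 -
      (blockEmb k l 0)ᴴ * ((C ⊗ₖ (1 : Matrix (l × Fin 2) (l × Fin 2) ℂ)) * A *
        (D ⊗ₖ (1 : Matrix (l × Fin 2) (l × Fin 2) ℂ))) * blockEmb k l 1 := by
    rw [blockEmb_compress_kronecker, blockEmb_compress_kronecker, ← Matrix.sub_mul,
      ← Matrix.mul_sub, ← eq_compress_sub_compress h]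
  rw [h1]
  refine (schattenNorm_compress_sub_le hA hB (isContraction_blockEmb 0) (isContraction_blockEmb 1)
    C D hp).trans ?_
  rw [add_comm, add_mul]
  exact add_le_add (interpBound_le hA C D hp0 hpq) (interpBound_le hB C D hp0 hpq)

end Sup

/-! ### The case `q < p` -/

section Inf

variable {k l : Type*} [Fintype k] [DecidableEq k] [Fintype l] [DecidableEq l]

theorem exists_inverse_weights {A : Matrix k k ℂ} (hA : A.PosSemidef) {p q ε : ℝ} (hq : 0 < q)
    (hqp : q < p) (hε : 0 < ε) :
    ∃ c C : Matrix k k ℂ, c * C = 1 ∧ C * c = 1 ∧ Cᴴ = C ∧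
      schattenNorm (2 * ncR (ENNReal.ofReal p) (ENNReal.ofReal q)) c *
        schattenNorm (2 * ncR (ENNReal.ofReal p) (ENNReal.ofReal q)) c =
          (∑ i, (hA.isHermitian.eigenvalues i + ε) ^ (q / p)) ^ (1 / q - 1 / p) ∧
      (A * mrpow (Cᴴ * C) p).trace.re ≤ ∑ i, (hA.isHermitian.eigenvalues i + ε) ^ (q / p) := by
  have hp : 0 < p := hq.trans hqp
  have hd : 0 < p - q := sub_pos.2 hqp
  set t : ℝ := (p - q) / p ^ 2 with ht
  have hH := hA.isHermitian
  have hpow : ∀ u : ℝ, (spectralMap A fun x => (((x + ε) ^ (u / 2) : ℝ) : ℂ))ᴴ *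
      (spectralMap A fun x => (((x + ε) ^ (u / 2) : ℝ) : ℂ)) =
      spectralMap A fun x => (((x + ε) ^ u : ℝ) : ℂ) := by
    intro u
    rw [spectralMap_conjTranspose hH, spectralMap_mul hH]
    refine spectralMap_congr_of_posSemidef hA fun x hx => ?_
    rw [Complex.star_def, Complex.conj_ofReal, ← Complex.ofReal_mul,
      ← Real.rpow_add (by linarith), add_halves]
  have hinv : ∀ u : ℝ, (spectralMap A fun x => (((x + ε) ^ (u / 2) : ℝ) : ℂ)) *
      (spectralMap A fun x => (((x + ε) ^ (-u / 2) : ℝ) : ℂ)) = 1 := by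
    intro u
    rw [spectralMap_mul hH, ← spectralMap_one hH]
    refine spectralMap_congr_of_posSemidef hA fun x hx => ?_
    rw [← Complex.ofReal_mul, ← Real.rpow_add (by linarith), neg_div, add_neg_cancel,
      Real.rpow_zero, Complex.ofReal_one]
  have hmr : ∀ u e : ℝ, mrpow (spectralMap A fun x => (((x + ε) ^ u : ℝ) : ℂ)) e =
      spectralMap A fun x => (((x + ε) ^ (u * e) : ℝ) : ℂ) := by
    intro u e
    rw [mrpow_spectralMap hH fun x => (x + ε) ^ u]
    refine spectralMap_congr_of_posSemidef hA fun x hx => ?_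
    rw [← Real.rpow_mul (by linarith)]
  have hS : 0 ≤ ∑ i, (hH.eigenvalues i + ε) ^ (q / p) := Finset.sum_nonneg fun i _ =>
    Real.rpow_nonneg (add_nonneg (hA.eigenvalues_nonneg i) hε.le) _
  refine ⟨_, _, hinv t, ?_, ?_, ?_, ?_⟩
  · have h := hinv (-t)
    rwa [neg_neg] at h
  · rw [spectralMap_conjTranspose hH]
    simp
  · have hr : 0 < q * p / (p - q) := by positivity
    rw [ncR_comm, two_mul_ncR_ofReal hq hqp, schattenNorm_ofReal _ (by positivity), hpow, hmr,
      trace_spectralMap hH, Complex.re_sum]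
    simp only [Complex.ofReal_re]
    have e1 : t * (2 * (q * p / (p - q)) / 2) = q / p := by
      rw [ht]
      field_simp
    rw [e1, ← Real.rpow_add_of_nonneg hS (by positivity) (by positivity)]
    congr 1
    field_simp
    ring
  · rw [hpow, hmr, self_mul_spectralMap hH, trace_spectralMap hH, Complex.re_sum]
    refine Finset.sum_le_sum fun i _ => ?_
    have h0 := hA.eigenvalues_nonneg i
    have h1 : 0 < hH.eigenvalues i + ε := by linarith
    rw [← Complex.ofReal_mul, Complex.ofReal_re]
    calc _ ≤ (hH.eigenvalues i + ε) * (hH.eigenvalues i + ε) ^ (-t * p) :=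
          mul_le_mul_of_nonneg_right (by linarith) (Real.rpow_nonneg h1.le _)
      _ = (hH.eigenvalues i + ε) ^ (1 + -t * p) := by
          rw [Real.rpow_add h1, Real.rpow_one]
      _ = _ := by
          congr 1
          rw [ht]
          field_simp
          ring

/-- A compression of `B ≥ 0` to an off-diagonal block factors through weights on the outside
space, at a cost close to `Psi p q B`. -/
theorem exists_factorization {B : Matrix (k × (l × Fin 2)) (k × (l × Fin 2)) ℂ}
    (hB : B.PosSemidef) {p q : ℝ} (hp : 1 ≤ p) (hq : 0 < q) (hqp : q < p) {δ : ℝ} (hδ : 0 < δ)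
    {J₀ J₁ : Matrix (k × (l × Fin 2)) (k × l) ℂ} (hJ₀ : IsContraction J₀) (hJ₁ : IsContraction J₁)
    (hcomp : ∀ (C D : Matrix k k ℂ) (X : Matrix (k × (l × Fin 2)) (k × (l × Fin 2)) ℂ), J₀ᴴ * ((C ⊗ₖ (1 : Matrix (l × Fin 2) (l × Fin 2) ℂ)) * X *
      (D ⊗ₖ (1 : Matrix (l × Fin 2) (l × Fin 2) ℂ))) * J₁ =
      (C ⊗ₖ (1 : Matrix l l ℂ)) * (J₀ᴴ * X * J₁) * (D ⊗ₖ (1 : Matrix l l ℂ))) :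
    ∃ (c : Matrix k k ℂ) (Z : Matrix (k × l) (k × l) ℂ),
      J₀ᴴ * B * J₁ = (c ⊗ₖ (1 : Matrix l l ℂ)) * Z * (c ⊗ₖ (1 : Matrix l l ℂ)) ∧
      schattenNorm (2 * ncR (ENNReal.ofReal p) (ENNReal.ofReal q)) c *
        schattenNorm (2 * ncR (ENNReal.ofReal p) (ENNReal.ofReal q)) c *
        schattenNorm (ENNReal.ofReal p) Z ≤ Psi p q B + δ := by
  have hp0 : 0 < p := by linarith
  have hσ := ptrace2_posSemidef (mrpow_posSemidef hB p)
  have hσ0 := hσ.eigenvalues_nonneg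
  obtain ⟨ε, hε, hlt⟩ : ∃ ε : ℝ, 0 < ε ∧
      (∑ i, (hσ.isHermitian.eigenvalues i + ε) ^ (q / p)) ^ (1 / q) < Psi p q B + δ := by
    have hcont : Continuous fun ε : ℝ =>
        (∑ i, (hσ.isHermitian.eigenvalues i + ε) ^ (q / p)) ^ (1 / q) := by
      refine Continuous.rpow_const (continuous_finsetSum _ fun i _ =>
        (continuous_const.add continuous_id).rpow_const fun _ => Or.inr (by positivity))
        fun _ => Or.inr (by positivity)
    have h0 : (∑ i, (hσ.isHermitian.eigenvalues i + 0) ^ (q / p)) ^ (1 / q) < Psi p q B + δ := by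
      rw [Psi, trace_mrpow hσ.isHermitian]
      simpa using hδ
    have hev := (hcont.tendsto 0).eventually_lt_const h0
    obtain ⟨ε, h1, h2⟩ := ((hev.filter_mono nhdsWithin_le_nhds).and
      (self_mem_nhdsWithin (s := Set.Ioi (0 : ℝ)))).exists
    exact ⟨ε, h2, h1⟩
  set S := ∑ i, (hσ.isHermitian.eigenvalues i + ε) ^ (q / p) with hS
  have hS0 : 0 ≤ S := Finset.sum_nonneg fun i _ =>
    Real.rpow_nonneg (add_nonneg (hσ0 i) hε.le) _
  obtain ⟨c, C, hcC, hCc, hCs, hc, hC⟩ := exists_inverse_weights hσ hq hqp hε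
  refine ⟨c, J₀ᴴ * ((C ⊗ₖ (1 : Matrix (l × Fin 2) (l × Fin 2) ℂ)) * B *
      (C ⊗ₖ (1 : Matrix (l × Fin 2) (l × Fin 2) ℂ))) * J₁, ?_, ?_⟩
  · rw [hcomp]
    simp only [← Matrix.mul_assoc, ← Matrix.mul_kronecker_mul, hcC, Matrix.one_mul,
      Matrix.one_kronecker_one]
    simp only [Matrix.mul_assoc, ← Matrix.mul_kronecker_mul, hCc,
      Matrix.one_kronecker_one, Matrix.mul_one]
  · have hZ : interpBound p B C C ≤ S ^ (1 / p) := by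
      have e : C * Cᴴ = Cᴴ * C := by rw [hCs]
      rw [interpBound, e]
      refine Real.rpow_le_rpow (mul_nonneg (Real.sqrt_nonneg _) (Real.sqrt_nonneg _)) ?_
        (by positivity)
      exact (mul_self_le_mul_self (Real.sqrt_nonneg _) (Real.sqrt_le_sqrt hC)).trans_eq
        (Real.mul_self_sqrt hS0)
    have h1 := (schattenNorm_compress_le hB hJ₀ hJ₁ C C hp).trans hZ
    have hpq : 0 ≤ 1 / q - 1 / p := sub_nonneg.2 (one_div_le_one_div_of_le hq hqp.le)
    refine le_trans ?_ hlt.le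
    rw [hc]
    refine (mul_le_mul_of_nonneg_left h1 (Real.rpow_nonneg hS0 _)).trans_eq ?_
    rw [← Real.rpow_add_of_nonneg hS0 hpq (by positivity), sub_add_cancel]

theorem ncNormInf_le {A B : Matrix (k × (l × Fin 2)) (k × (l × Fin 2)) ℂ} (hA : A.PosSemidef)
    (hB : B.PosSemidef) {Y : Matrix (k × l) (k × l) ℂ} (h : clBlock Y + A = B) {p q : ℝ}
    (hp : 1 ≤ p) (hq : 0 < q) (hqp : q < p) :
    ncNormInf (ENNReal.ofReal p) (ENNReal.ofReal q) Y ≤ Psi p q A + Psi p q B := by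
  refine le_of_forall_pos_le_add fun δ hδ => ?_
  have hJ : IsContraction (-blockEmb k l 0) := by
    have h0 := isContraction_blockEmb (k := k) (l := l) 0
    rwa [IsContraction, Matrix.conjTranspose_neg, Matrix.neg_mul, Matrix.mul_neg, neg_neg]
  obtain ⟨c, Z, hZ, hcZ⟩ := exists_factorization hB hp hq hqp (half_pos hδ)
    (isContraction_blockEmb (k := k) (l := l) 0) (isContraction_blockEmb 1)
    fun C D X => blockEmb_compress_kronecker C D X 0 1
  obtain ⟨c', Z', hZ', hcZ'⟩ := exists_factorization hA hp hq hqp (half_pos hδ) hJ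
    (isContraction_blockEmb 1) fun C D X => by
      simp only [Matrix.conjTranspose_neg, Matrix.neg_mul, Matrix.mul_neg,
        blockEmb_compress_kronecker]
  have hY : Y = ∑ i : Fin 2, ((![c, c'] i) ⊗ₖ (1 : Matrix l l ℂ)) * (![Z, Z'] i) *
      ((![c, c'] i) ⊗ₖ (1 : Matrix l l ℂ)) := by
    rw [Fin.sum_univ_two]
    simp only [Matrix.cons_val_zero, Matrix.cons_val_one, ← hZ, ← hZ']
    rw [Matrix.conjTranspose_neg, Matrix.neg_mul, Matrix.neg_mul, ← sub_eq_add_neg]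
    exact eq_compress_sub_compress h
  have hle : ncNormInf (ENNReal.ofReal p) (ENNReal.ofReal q) Y ≤
      ∑ i : Fin 2, schattenNorm (2 * ncR (ENNReal.ofReal p) (ENNReal.ofReal q)) (![c, c'] i) *
        schattenNorm (2 * ncR (ENNReal.ofReal p) (ENNReal.ofReal q)) (![c, c'] i) *
        schattenNorm (ENNReal.ofReal p) (![Z, Z'] i) := by
    refine csInf_le ⟨0, ?_⟩ ⟨2, ![c, c'], ![c, c'], ![Z, Z'], hY, rfl⟩
    rintro _ ⟨N, A, B, Z, -, rfl⟩
    exact Finset.sum_nonneg fun i _ => mul_nonneg (mul_nonneg (schattenNorm_nonneg _ _)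
      (schattenNorm_nonneg _ _)) (schattenNorm_nonneg _ _)
  rw [Fin.sum_univ_two] at hle
  simp only [Matrix.cons_val_zero, Matrix.cons_val_one] at hle
  linarith

end Inf

/-! ### Comparison with the Carlen–Lieb norm -/

section Main

variable {k l : Type*} [Fintype k] [DecidableEq k] [Fintype l] [DecidableEq l]

theorem exists_posSemidef_add_eq {X : Matrix k k ℂ} (hX : X.IsHermitian) :
    ∃ A B : Matrix k k ℂ, A.PosSemidef ∧ B.PosSemidef ∧ X + A = B := by
  refine ⟨_, _, Matrix.posSemidef_conjTranspose_mul_self ((1 / 2 : ℂ) • (X - 1)),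
    Matrix.posSemidef_conjTranspose_mul_self ((1 / 2 : ℂ) • (X + 1)), ?_⟩
  have hX' : Xᴴ = X := hX
  simp only [Matrix.conjTranspose_smul, Matrix.conjTranspose_sub, Matrix.conjTranspose_add, hX',
    Matrix.conjTranspose_one, Matrix.smul_mul, Matrix.mul_smul, Matrix.mul_sub, Matrix.sub_mul,
    Matrix.mul_add, Matrix.add_mul, Matrix.mul_one, Matrix.one_mul]
  have h2 : star (1 / 2 : ℂ) = 1 / 2 := by simp
  rw [h2]
  module

theorem ncNorm_le_tripleNorm (Y : Matrix (k × l) (k × l) ℂ) {p q : ℝ} (hp : 1 ≤ p) (hq : 0 < q) :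
    ncNorm (ENNReal.ofReal p) (ENNReal.ofReal q) Y ≤ tripleNorm p q (clBlock Y) := by
  obtain ⟨A, B, hA, hB, h⟩ := exists_posSemidef_add_eq (clBlock_isHermitian Y)
  refine le_csInf ⟨_, A, B, hA, hB, h, rfl⟩ ?_
  rintro _ ⟨A, B, hA, hB, h, rfl⟩
  rw [ncNorm]
  split_ifs with hpq
  · exact ncNormSup_le hA hB h hp ((ENNReal.ofReal_le_ofReal_iff hq.le).1 hpq)
  · refine ncNormInf_le hA hB h hp hq (lt_of_not_ge fun h' => hpq (ENNReal.ofReal_le_ofReal h'))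

theorem tripleNorm_nonneg (p q : ℝ) (X : Matrix (k × (l × Fin 2)) (k × (l × Fin 2)) ℂ) :
    0 ≤ tripleNorm p q X := by
  refine Real.sInf_nonneg ?_
  rintro _ ⟨A, B, hA, hB, -, rfl⟩
  exact add_nonneg (Psi_nonneg p q hA) (Psi_nonneg p q hB)

end Main

/-- **The NC norm is bounded by `2^{3 - 1/p}` times the Carlen–Lieb norm**
(`1 ≤ p ≤ 2`, `q ≥ 1`). -/
theorem ncNorm_le_clNorm {n m : ℕ} (hn : 0 < n) (hm : 0 < m) (p q : ℝ)
    (hp1 : 1 ≤ p) (hp2 : p ≤ 2) (hq : 1 ≤ q)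
    (Y : Matrix (Fin n × Fin m) (Fin n × Fin m) ℂ) :
    ncNorm (ENNReal.ofReal p) (ENNReal.ofReal q) Y ≤ (2 : ℝ) ^ (3 - 1 / p) * clNorm p q Y := by
  have hp0 : 0 < p := by linarith
  have h1 : (2 : ℝ) ≤ 2 ^ (3 - 1 / p) := by
    have h2 : 1 / p ≤ 1 := (div_le_one hp0).2 hp1
    calc (2 : ℝ) = 2 ^ (1 : ℝ) := (Real.rpow_one 2).symm
      _ ≤ 2 ^ (3 - 1 / p) := Real.rpow_le_rpow_of_exponent_le one_le_two (by linarith)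
  have h3 := ncNorm_le_tripleNorm Y hp1 (zero_lt_one.trans_le hq)
  have h4 := tripleNorm_nonneg p q (clBlock Y)
  rw [clNorm]
  nlinarith
end

section
/- Let 1 ≤ p ≤ 2 and q ≥ 1. For every Hermitian matrix Y = Y* ∈ M_n ⊗ M_m, the Carlen–Lieb norm has the representation ‖Y‖_{CL} = inf{ Ψ_{p,q}( diag(Y + A, A) ) : A ≥ 0, Y + A ≥ 0 }, where diag(Y + A, A) denotes the block-diagonal matrix [[Y + A, 0],[0, A]] ∈ M_n ⊗ (M_m ⊗ M_2) and Ψ_{p,q} is computed with outside space M_n and inside space M_m ⊗ M_2. -/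
open scoped Kronecker
open Matrix
open scoped ENNReal NNReal ComplexOrder

section Spectral

variable {ι : Type*} [Fintype ι] [DecidableEq ι]

/-- The Hermitian matrix `U diag(d) Uᴴ` with eigenvalues `d` and eigenvectors the columns
of `U`. -/
noncomputable def spectralMatrix (U : Matrix ι ι ℂ) (d : ι → ℝ) : Matrix ι ι ℂ :=
  U * diagonal (fun i => (d i : ℂ)) * Uᴴ

theorem conjTranspose_mul_self_of_mem_unitaryGroup {U : Matrix ι ι ℂ}
    (hU : U ∈ unitaryGroup ι ℂ) : Uᴴ * U = 1 := by
  simpa [star_eq_conjTranspose] using mem_unitaryGroup_iff'.1 hU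

theorem self_mul_conjTranspose_of_mem_unitaryGroup {U : Matrix ι ι ℂ}
    (hU : U ∈ unitaryGroup ι ℂ) : U * Uᴴ = 1 := by
  simpa [star_eq_conjTranspose] using mem_unitaryGroup_iff.1 hU

theorem isHermitian_spectralMatrix (U : Matrix ι ι ℂ) (d : ι → ℝ) :
    (spectralMatrix U d).IsHermitian := by
  refine isHermitian_mul_mul_conjTranspose U ?_
  simp [IsHermitian, diagonal_conjTranspose, Pi.star_def]

theorem posSemidef_spectralMatrix (U : Matrix ι ι ℂ) {d : ι → ℝ} (hd : ∀ i, 0 ≤ d i) :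
    (spectralMatrix U d).PosSemidef := by
  refine PosSemidef.mul_mul_conjTranspose_same (posSemidef_diagonal_iff.2 fun i => ?_) U
  exact_mod_cast hd i

theorem Matrix.IsHermitian.exists_spectralMatrix {A : Matrix ι ι ℂ} (hA : A.IsHermitian) :
    A = spectralMatrix (hA.eigenvectorUnitary : Matrix ι ι ℂ) hA.eigenvalues := by
  conv_lhs => rw [hA.spectral_theorem]
  simp [spectralMatrix, Unitary.conjStarAlgAut_apply, star_eq_conjTranspose, Function.comp_def]

theorem Matrix.PosSemidef.exists_spectralMatrix {A : Matrix ι ι ℂ} (hA : A.PosSemidef) :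
    ∃ U ∈ unitaryGroup ι ℂ, ∃ d : ι → ℝ, (∀ i, 0 ≤ d i) ∧ A = spectralMatrix U d :=
  ⟨_, hA.isHermitian.eigenvectorUnitary.2, _, hA.eigenvalues_nonneg,
    hA.isHermitian.exists_spectralMatrix⟩

theorem Matrix.PosDef.exists_spectralMatrix {A : Matrix ι ι ℂ} (hA : A.PosDef) :
    ∃ U ∈ unitaryGroup ι ℂ, ∃ d : ι → ℝ, (∀ i, 0 < d i) ∧ A = spectralMatrix U d :=
  ⟨_, hA.isHermitian.eigenvectorUnitary.2, _, hA.eigenvalues_pos,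
    hA.isHermitian.exists_spectralMatrix⟩

theorem mrpow_spectralMatrix {U : Matrix ι ι ℂ} (hU : U ∈ unitaryGroup ι ℂ) (d : ι → ℝ)
    (e : ℝ) : mrpow (spectralMatrix U d) e = spectralMatrix U (fun i => d i ^ e) := by
  have hA := isHermitian_spectralMatrix U d
  have hUU := conjTranspose_mul_self_of_mem_unitaryGroup hU
  have hUU' := self_mul_conjTranspose_of_mem_unitaryGroup hU
  rw [mrpow, dif_pos hA]
  have hspec := hA.exists_spectralMatrix
  have hV : (hA.eigenvectorUnitary : Matrix ι ι ℂ) ∈ unitaryGroup ι ℂ := hA.eigenvectorUnitary.2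
  generalize (hA.eigenvectorUnitary : Matrix ι ι ℂ) = V at *
  generalize hA.eigenvalues = a at *
  have hVV := conjTranspose_mul_self_of_mem_unitaryGroup hV
  have hVV' := self_mul_conjTranspose_of_mem_unitaryGroup hV
  have h1 : diagonal (fun i => (d i : ℂ)) * (Uᴴ * V) = (Uᴴ * V) * diagonal (fun i => (a i : ℂ)) := by
    have : Uᴴ * spectralMatrix U d * V = Uᴴ * spectralMatrix V a * V := by rw [← hspec]
    simp only [spectralMatrix] at this
    calc _ = (Uᴴ * U) * diagonal (fun i => (d i : ℂ)) * (Uᴴ * V) := by rw [hUU, Matrix.one_mul]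
      _ = Uᴴ * (U * diagonal (fun i => (d i : ℂ)) * Uᴴ) * V := by simp only [Matrix.mul_assoc]
      _ = Uᴴ * (V * diagonal (fun i => (a i : ℂ)) * Vᴴ) * V := this
      _ = (Uᴴ * V) * diagonal (fun i => (a i : ℂ)) * (Vᴴ * V) := by simp only [Matrix.mul_assoc]
      _ = _ := by rw [hVV, Matrix.mul_one]
  have h2 : diagonal (fun i => ((d i ^ e : ℝ) : ℂ)) * (Uᴴ * V) =
      (Uᴴ * V) * diagonal (fun i => ((a i ^ e : ℝ) : ℂ)) := by
    ext i j
    have h := congrFun (congrFun h1 i) j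
    rw [diagonal_mul, mul_diagonal] at h ⊢
    by_cases hT : (Uᴴ * V) i j = 0
    · simp [hT]
    · rw [mul_comm] at h
      have h' : (d i : ℂ) = a j := mul_left_cancel₀ hT h
      rw [Complex.ofReal_inj.1 h', mul_comm]
  symm
  calc spectralMatrix U (fun i => d i ^ e)
      = U * (diagonal (fun i => ((d i ^ e : ℝ) : ℂ)) * (Uᴴ * V)) * Vᴴ := by
        simp only [spectralMatrix, Matrix.mul_assoc, hVV', Matrix.mul_one]
    _ = (U * Uᴴ) * V * diagonal (fun i => ((a i ^ e : ℝ) : ℂ)) * Vᴴ := by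
        rw [h2]; simp only [Matrix.mul_assoc]
    _ = _ := by rw [hUU', Matrix.one_mul]

theorem conj_spectralMatrix (K U : Matrix ι ι ℂ) (d : ι → ℝ) :
    K * spectralMatrix U d * Kᴴ = spectralMatrix (K * U) d := by
  simp only [spectralMatrix, conjTranspose_mul, Matrix.mul_assoc]

theorem posSemidef_mrpow {A : Matrix ι ι ℂ} (hA : A.PosSemidef) (e : ℝ) :
    (mrpow A e).PosSemidef := by
  obtain ⟨U, hU, d, hd, rfl⟩ := hA.exists_spectralMatrix
  rw [mrpow_spectralMatrix hU]
  exact posSemidef_spectralMatrix U fun i => Real.rpow_nonneg (hd i) e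

theorem mrpow_unitary_conj {A K : Matrix ι ι ℂ} (hA : A.PosSemidef) (hK : K ∈ unitaryGroup ι ℂ)
    (e : ℝ) : mrpow (K * A * Kᴴ) e = K * mrpow A e * Kᴴ := by
  obtain ⟨U, hU, d, hd, rfl⟩ := hA.exists_spectralMatrix
  rw [conj_spectralMatrix, mrpow_spectralMatrix (mul_mem hK hU), mrpow_spectralMatrix hU,
    conj_spectralMatrix]

theorem smul_spectralMatrix (c : ℝ) (U : Matrix ι ι ℂ) (d : ι → ℝ) :
    c • spectralMatrix U d = spectralMatrix U (fun i => c * d i) := by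
  have : diagonal (fun i => ((c * d i : ℝ) : ℂ)) = c • diagonal (fun i => (d i : ℂ)) := by
    ext i j; by_cases h : i = j <;> simp [h, diagonal]
  simp only [spectralMatrix, this, Matrix.mul_smul, Matrix.smul_mul]

theorem mrpow_smul {A : Matrix ι ι ℂ} (hA : A.PosSemidef) {c : ℝ} (hc : 0 ≤ c) (e : ℝ) :
    mrpow (c • A) e = c ^ e • mrpow A e := by
  obtain ⟨U, hU, d, hd, rfl⟩ := hA.exists_spectralMatrix
  rw [smul_spectralMatrix, mrpow_spectralMatrix hU, mrpow_spectralMatrix hU, smul_spectralMatrix]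
  congr 1; ext i
  exact Real.mul_rpow hc (hd i)

theorem spectralMatrix_one {U : Matrix ι ι ℂ} (hU : U ∈ unitaryGroup ι ℂ) :
    spectralMatrix U (fun _ => 1) = 1 := by
  simp [spectralMatrix, self_mul_conjTranspose_of_mem_unitaryGroup hU]

theorem mrpow_one {A : Matrix ι ι ℂ} (hA : A.PosSemidef) : mrpow A 1 = A := by
  obtain ⟨U, hU, d, hd, rfl⟩ := hA.exists_spectralMatrix
  simp [mrpow_spectralMatrix hU]

theorem mrpow_zero {A : Matrix ι ι ℂ} (hA : A.PosSemidef) : mrpow A 0 = 1 := by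
  obtain ⟨U, hU, d, hd, rfl⟩ := hA.exists_spectralMatrix
  simp [mrpow_spectralMatrix hU, spectralMatrix_one hU]

theorem one_mrpow (e : ℝ) : mrpow (1 : Matrix ι ι ℂ) e = 1 := by
  have h := mrpow_spectralMatrix (one_mem (unitaryGroup ι ℂ)) (fun _ => 1) e
  simpa [spectralMatrix_one (one_mem (unitaryGroup ι ℂ))] using h

theorem spectralMatrix_mul_spectralMatrix {U : Matrix ι ι ℂ} (hU : U ∈ unitaryGroup ι ℂ)
    (d f : ι → ℝ) :
    spectralMatrix U d * spectralMatrix U f = spectralMatrix U (fun i => d i * f i) := by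
  calc spectralMatrix U d * spectralMatrix U f
      = U * diagonal (fun i => (d i : ℂ)) * (Uᴴ * U) * diagonal (fun i => (f i : ℂ)) * Uᴴ := by
        simp only [spectralMatrix, Matrix.mul_assoc]
    _ = U * (diagonal (fun i => (d i : ℂ)) * diagonal (fun i => (f i : ℂ))) * Uᴴ := by
        rw [conjTranspose_mul_self_of_mem_unitaryGroup hU, Matrix.mul_one]
        simp only [Matrix.mul_assoc]
    _ = _ := by rw [diagonal_mul_diagonal]; simp [spectralMatrix]

theorem mrpow_half_mul_self {A : Matrix ι ι ℂ} (hA : A.PosSemidef) (e : ℝ) :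
    (mrpow A (e / 2))ᴴ * mrpow A (e / 2) = mrpow A e := by
  rw [(posSemidef_mrpow hA _).isHermitian.eq]
  obtain ⟨U, hU, d, hd, rfl⟩ := hA.exists_spectralMatrix
  rw [mrpow_spectralMatrix hU, mrpow_spectralMatrix hU, spectralMatrix_mul_spectralMatrix hU]
  congr 1; ext i
  rw [← sq, ← Real.rpow_mul_natCast (hd i)]
  norm_num

theorem trace_spectralMatrix {U : Matrix ι ι ℂ} (hU : U ∈ unitaryGroup ι ℂ) (d : ι → ℝ) :
    (trace (spectralMatrix U d)).re = ∑ i, d i := by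
  rw [spectralMatrix, trace_mul_comm, ← Matrix.mul_assoc,
    conjTranspose_mul_self_of_mem_unitaryGroup hU, Matrix.one_mul]
  simp [trace]

theorem trace_spectralMatrix_mul {κ : Type*} [Fintype κ] [DecidableEq κ]
    (U : Matrix ι ι ℂ) (V : Matrix κ κ ℂ) (d : ι → ℝ) (f : κ → ℝ) (W M : Matrix κ ι ℂ) :
    (trace (spectralMatrix U d * Wᴴ * spectralMatrix V f * M)).re =
      ∑ j, ∑ i, d i * f j * (star ((Vᴴ * W * U) j i) * (Vᴴ * M * U) j i).re := by
  have h : trace (spectralMatrix U d * Wᴴ * spectralMatrix V f * M) =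
      trace ((Vᴴ * W * U)ᴴ * diagonal (fun i => (f i : ℂ)) * (Vᴴ * M * U) *
        diagonal (fun i => (d i : ℂ))) := by
    simp only [spectralMatrix, conjTranspose_mul, conjTranspose_conjTranspose]
    rw [Matrix.mul_assoc U, Matrix.mul_assoc U, Matrix.mul_assoc U, Matrix.mul_assoc U,
      trace_mul_comm U, Matrix.mul_assoc (diagonal _), Matrix.mul_assoc (diagonal _),
      Matrix.mul_assoc (diagonal _), Matrix.mul_assoc (diagonal _), trace_mul_comm (diagonal _)]
    simp only [Matrix.mul_assoc]
  rw [h, trace, Finset.sum_comm, Complex.re_sum]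
  refine Finset.sum_congr rfl fun i _ => ?_
  rw [diag_apply, mul_diagonal, mul_apply, Finset.sum_mul, Complex.re_sum]
  refine Finset.sum_congr rfl fun j _ => ?_
  rw [mul_diagonal, conjTranspose_apply]
  simp
  ring

theorem trace_spectralMatrix_mul_self {κ : Type*} [Fintype κ] [DecidableEq κ]
    (U : Matrix ι ι ℂ) (V : Matrix κ κ ℂ) (d : ι → ℝ) (f : κ → ℝ) (M : Matrix κ ι ℂ) :
    (trace (spectralMatrix U d * Mᴴ * spectralMatrix V f * M)).re =
      ∑ j, ∑ i, d i * f j * Complex.normSq ((Vᴴ * M * U) j i) := by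
  simp [trace_spectralMatrix_mul, Complex.normSq_apply]

end Spectral


section JointConvexity

variable {ι κ : Type*} [Fintype ι] [DecidableEq ι] [Fintype κ] [DecidableEq κ]

/-- The functional, affine in `(A, X)`, whose supremum over `W` is the quadratic-over-linear form
`∑ a² / (α a + β x) |m|²` in the eigenvalues `a` of `A` and `x` of `X`. -/
noncomputable def quadOverLinForm (α β : ℝ) (M W : Matrix κ ι ℂ) (A : Matrix ι ι ℂ)
    (X : Matrix κ κ ℂ) : ℝ :=
  2 * (trace (A * Wᴴ * M)).re - α * (trace (A * Wᴴ * W)).re - β * (trace (Wᴴ * X * W)).re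

omit [DecidableEq ι] [DecidableEq κ] in
theorem quadOverLinForm_combo (α β t s : ℝ) (M W : Matrix κ ι ℂ) (A₁ A₂ : Matrix ι ι ℂ)
    (X₁ X₂ : Matrix κ κ ℂ) :
    quadOverLinForm α β M W (t • A₁ + s • A₂) (t • X₁ + s • X₂) =
      t * quadOverLinForm α β M W A₁ X₁ + s * quadOverLinForm α β M W A₂ X₂ := by
  simp only [quadOverLinForm, Matrix.add_mul, Matrix.mul_add, Matrix.smul_mul, Matrix.mul_smul,
    trace_add, trace_smul, Complex.add_re, Complex.smul_re, smul_eq_mul]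
  ring

theorem quadOverLinForm_spectralMatrix {U : Matrix ι ι ℂ} {V : Matrix κ κ ℂ}
    (hU : U ∈ unitaryGroup ι ℂ) (hV : V ∈ unitaryGroup κ ℂ) (α β : ℝ) (M W : Matrix κ ι ℂ)
    (a : ι → ℝ) (x : κ → ℝ) :
    quadOverLinForm α β M W (spectralMatrix U a) (spectralMatrix V x) =
      ∑ j, ∑ i, (2 * a i * (star ((Vᴴ * W * U) j i) * (Vᴴ * M * U) j i).re -
        (α * a i + β * x j) * Complex.normSq ((Vᴴ * W * U) j i)) := by
  have h1 := trace_spectralMatrix_mul U V a (fun _ => 1) W M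
  have h2 := trace_spectralMatrix_mul_self U V a (fun _ => 1) W
  have h3 := trace_spectralMatrix_mul_self U V (fun _ => 1) x W
  rw [spectralMatrix_one hV, Matrix.mul_one] at h1 h2
  rw [spectralMatrix_one hU, Matrix.one_mul] at h3
  rw [quadOverLinForm, h1, h2, h3]
  simp only [Finset.mul_sum, ← Finset.sum_sub_distrib]
  refine Finset.sum_congr rfl fun j _ => Finset.sum_congr rfl fun i _ => ?_
  ring

theorem quadOverLinForm_le {U : Matrix ι ι ℂ} {V : Matrix κ κ ℂ}
    (hU : U ∈ unitaryGroup ι ℂ) (hV : V ∈ unitaryGroup κ ℂ) {α β : ℝ} (hα : 0 ≤ α) (hβ : 0 < β)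
    (M W : Matrix κ ι ℂ) {a : ι → ℝ} {x : κ → ℝ} (ha : ∀ i, 0 ≤ a i) (hx : ∀ j, 0 < x j) :
    quadOverLinForm α β M W (spectralMatrix U a) (spectralMatrix V x) ≤
      ∑ j, ∑ i, a i ^ 2 / (α * a i + β * x j) * Complex.normSq ((Vᴴ * M * U) j i) := by
  rw [quadOverLinForm_spectralMatrix hU hV]
  refine Finset.sum_le_sum fun j _ => Finset.sum_le_sum fun i _ => ?_
  have hc : 0 < α * a i + β * x j :=
    add_pos_of_nonneg_of_pos (mul_nonneg hα (ha i)) (mul_pos hβ (hx j))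
  generalize (Vᴴ * W * U) j i = w
  generalize (Vᴴ * M * U) j i = m
  generalize α * a i + β * x j = c at *
  generalize a i = b
  have key : b ^ 2 / c * Complex.normSq m - (2 * b * (star w * m).re - c * Complex.normSq w) =
      ((b * m.re - c * w.re) ^ 2 + (b * m.im - c * w.im) ^ 2) / c := by
    simp only [Complex.normSq_apply, Complex.star_def, Complex.mul_re, Complex.conj_re,
      Complex.conj_im]
    field_simp
    ring
  have : 0 ≤ ((b * m.re - c * w.re) ^ 2 + (b * m.im - c * w.im) ^ 2) / c := by positivity
  linarith

theorem exists_quadOverLinForm_eq {U : Matrix ι ι ℂ} {V : Matrix κ κ ℂ}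
    (hU : U ∈ unitaryGroup ι ℂ) (hV : V ∈ unitaryGroup κ ℂ) {α β : ℝ} (hα : 0 ≤ α) (hβ : 0 < β)
    (M : Matrix κ ι ℂ) {a : ι → ℝ} {x : κ → ℝ} (ha : ∀ i, 0 ≤ a i) (hx : ∀ j, 0 < x j) :
    ∃ W : Matrix κ ι ℂ, quadOverLinForm α β M W (spectralMatrix U a) (spectralMatrix V x) =
      ∑ j, ∑ i, a i ^ 2 / (α * a i + β * x j) * Complex.normSq ((Vᴴ * M * U) j i) := by
  let w : Matrix κ ι ℂ := fun j i => ((a i / (α * a i + β * x j) : ℝ) : ℂ) * (Vᴴ * M * U) j i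
  refine ⟨V * w * Uᴴ, ?_⟩
  have hw : Vᴴ * (V * w * Uᴴ) * U = w := by
    calc _ = (Vᴴ * V) * w * (Uᴴ * U) := by simp only [Matrix.mul_assoc]
      _ = w := by
        rw [conjTranspose_mul_self_of_mem_unitaryGroup hU,
          conjTranspose_mul_self_of_mem_unitaryGroup hV, Matrix.one_mul, Matrix.mul_one]
  rw [quadOverLinForm_spectralMatrix hU hV, hw]
  refine Finset.sum_congr rfl fun j _ => Finset.sum_congr rfl fun i _ => ?_
  have hc : 0 < α * a i + β * x j :=
    add_pos_of_nonneg_of_pos (mul_nonneg hα (ha i)) (mul_pos hβ (hx j))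
  simp only [w]
  generalize (Vᴴ * M * U) j i = m
  generalize α * a i + β * x j = c at *
  generalize a i = b
  simp only [Complex.normSq_apply, Complex.star_def, Complex.mul_re, Complex.mul_im,
    Complex.conj_re, Complex.conj_im, Complex.ofReal_re, Complex.ofReal_im]
  field_simp
  ring

theorem sum_quadOverLin_convex {α β : ℝ} (hα : 0 ≤ α) (hβ : 0 < β) (M : Matrix κ ι ℂ)
    {U U₁ U₂ : Matrix ι ι ℂ} {V V₁ V₂ : Matrix κ κ ℂ} {a a₁ a₂ : ι → ℝ} {x x₁ x₂ : κ → ℝ}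
    (hU : U ∈ unitaryGroup ι ℂ) (hU₁ : U₁ ∈ unitaryGroup ι ℂ) (hU₂ : U₂ ∈ unitaryGroup ι ℂ)
    (hV : V ∈ unitaryGroup κ ℂ) (hV₁ : V₁ ∈ unitaryGroup κ ℂ) (hV₂ : V₂ ∈ unitaryGroup κ ℂ)
    (ha : ∀ i, 0 ≤ a i) (ha₁ : ∀ i, 0 ≤ a₁ i) (ha₂ : ∀ i, 0 ≤ a₂ i)
    (hx : ∀ i, 0 < x i) (hx₁ : ∀ i, 0 < x₁ i) (hx₂ : ∀ i, 0 < x₂ i)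
    {t s : ℝ} (ht : 0 ≤ t) (hs : 0 ≤ s)
    (hA : spectralMatrix U a = t • spectralMatrix U₁ a₁ + s • spectralMatrix U₂ a₂)
    (hX : spectralMatrix V x = t • spectralMatrix V₁ x₁ + s • spectralMatrix V₂ x₂) :
    ∑ j, ∑ i, a i ^ 2 / (α * a i + β * x j) * Complex.normSq ((Vᴴ * M * U) j i) ≤
      t * ∑ j, ∑ i, a₁ i ^ 2 / (α * a₁ i + β * x₁ j) * Complex.normSq ((V₁ᴴ * M * U₁) j i) +
      s * ∑ j, ∑ i, a₂ i ^ 2 / (α * a₂ i + β * x₂ j) * Complex.normSq ((V₂ᴴ * M * U₂) j i) := by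
  obtain ⟨W, hW⟩ := exists_quadOverLinForm_eq hU hV hα hβ M ha hx
  rw [← hW, hA, hX, quadOverLinForm_combo]
  exact add_le_add
    (mul_le_mul_of_nonneg_left (quadOverLinForm_le hU₁ hV₁ hα hβ M W ha₁ hx₁) ht)
    (mul_le_mul_of_nonneg_left (quadOverLinForm_le hU₂ hV₂ hα hβ M W ha₂ hx₂) hs)

open MeasureTheory Set in
/-- For `1 < p < 2`, `a ^ p * x ^ (1 - p)` is a mixture of the functions `a² / (a + l x)`. -/
theorem exists_measure_rpow_mul_rpow_eq_integral {p : ℝ} (hp1 : 1 < p) (hp2 : p < 2) :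
    ∃ μ : Measure ℝ, ∀ a x : ℝ, 0 ≤ a → 0 < x →
      IntegrableOn (fun l => l ^ (p - 2) * (a ^ 2 / (1 * a + l * x))) (Ioi 0) μ ∧
      a ^ p * x ^ (1 - p) = ∫ l in Ioi 0, l ^ (p - 2) * (a ^ 2 / (1 * a + l * x)) ∂μ := by
  have hp : p - 1 ∈ Ioo (0 : ℝ) 1 := ⟨by linarith, by linarith⟩
  obtain ⟨μ, hμ⟩ := Real.exists_measure_rpow_eq_integral_rpowIntegrand₀₁ hp
  refine ⟨μ, fun a x ha hx => ?_⟩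
  obtain ⟨h1, h2⟩ := hμ (a / x) (mem_Ici.2 (div_nonneg ha hx.le))
  have heq : EqOn (fun l => a * Real.rpowIntegrand₀₁ (p - 1) l (a / x))
      (fun l => l ^ (p - 2) * (a ^ 2 / (1 * a + l * x))) (Ioi 0) := by
    intro l hl
    have hl : 0 < l := hl
    have hne : 0 < a + l * x := add_pos_of_nonneg_of_pos ha (mul_pos hl hx)
    have hne' : l + a / x = (a + l * x) / x := by field_simp; ring
    simp only []
    rw [Real.rpowIntegrand₀₁_eq_pow_div hp hl.le (div_nonneg ha hx.le), hne',
      show p - 1 - 1 = p - 2 by ring, one_mul]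
    field_simp
  have hval : a ^ p * x ^ (1 - p) = a * (a / x) ^ (p - 1) := by
    rw [Real.div_rpow ha hx.le, show (1 - p) = -(p - 1) by ring, Real.rpow_neg hx.le]
    have : a ^ p = a * a ^ (p - 1) := by
      rcases ha.eq_or_lt with rfl | ha
      · rw [Real.zero_rpow (by linarith)]; simp
      · rw [← Real.rpow_one_add' ha.le (by linarith)]; ring_nf
    rw [this]; ring
  refine ⟨IntegrableOn.congr_fun (h1.const_mul a) heq measurableSet_Ioi, ?_⟩
  rw [hval, h2, ← integral_const_mul, setIntegral_congr_fun measurableSet_Ioi heq]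

open MeasureTheory Set in
/-- **Ando's convexity theorem**: `(A, X) ↦ Tr (A ^ p Mᴴ X ^ (1 - p) M)` is jointly convex for
`1 ≤ p ≤ 2`. -/
theorem trace_mrpow_mul_mrpow_convex {p : ℝ} (hp1 : 1 ≤ p) (hp2 : p ≤ 2) (M : Matrix κ ι ℂ)
    {A₁ A₂ : Matrix ι ι ℂ} {X₁ X₂ : Matrix κ κ ℂ} (hA₁ : A₁.PosSemidef) (hA₂ : A₂.PosSemidef)
    (hX₁ : X₁.PosDef) (hX₂ : X₂.PosDef) {t s : ℝ} (ht : 0 ≤ t) (hs : 0 ≤ s) (hts : t + s = 1) :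
    (trace (mrpow (t • A₁ + s • A₂) p * Mᴴ * mrpow (t • X₁ + s • X₂) (1 - p) * M)).re ≤
      t * (trace (mrpow A₁ p * Mᴴ * mrpow X₁ (1 - p) * M)).re +
      s * (trace (mrpow A₂ p * Mᴴ * mrpow X₂ (1 - p) * M)).re := by
  have hA : (t • A₁ + s • A₂).PosSemidef := (hA₁.smul ht).add (hA₂.smul hs)
  have hX : (t • X₁ + s • X₂).PosDef := by
    rcases ht.eq_or_lt with rfl | ht
    · obtain rfl : s = 1 := by linarith
      simpa using hX₂
    · exact (hX₁.smul ht).add_posSemidef (hX₂.posSemidef.smul hs)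
  rcases hp1.eq_or_lt with rfl | hp1
  · rw [sub_self, mrpow_zero hX.posSemidef, mrpow_zero hX₁.posSemidef, mrpow_zero hX₂.posSemidef,
      mrpow_one hA, mrpow_one hA₁, mrpow_one hA₂]
    simp only [Matrix.add_mul, Matrix.smul_mul, trace_add, trace_smul, Complex.add_re,
      Complex.smul_re, smul_eq_mul, le_refl]
  obtain ⟨U, hU, a, ha, hAe⟩ := hA.exists_spectralMatrix
  obtain ⟨U₁, hU₁, a₁, ha₁, rfl⟩ := hA₁.exists_spectralMatrix
  obtain ⟨U₂, hU₂, a₂, ha₂, rfl⟩ := hA₂.exists_spectralMatrix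
  obtain ⟨V, hV, x, hx, hXe⟩ := hX.exists_spectralMatrix
  obtain ⟨V₁, hV₁, x₁, hx₁, rfl⟩ := hX₁.exists_spectralMatrix
  obtain ⟨V₂, hV₂, x₂, hx₂, rfl⟩ := hX₂.exists_spectralMatrix
  rw [hAe, hXe]
  simp only [mrpow_spectralMatrix, hU, hU₁, hU₂, hV, hV₁, hV₂, trace_spectralMatrix_mul_self]
  have key : ∀ {α β : ℝ}, 0 ≤ α → 0 < β → _ := fun {α β} hα hβ =>
    sum_quadOverLin_convex hα hβ M hU hU₁ hU₂ hV hV₁ hV₂ ha ha₁ ha₂ hx hx₁ hx₂ ht hs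
      hAe.symm hXe.symm
  rcases hp2.eq_or_lt with rfl | hp2
  · have h := key le_rfl one_pos
    have hform : ∀ b y : ℝ, 0 < y → b ^ (2 : ℝ) * y ^ (1 - 2 : ℝ) = b ^ 2 / (0 * b + 1 * y) := by
      intro b y hy
      rw [show (1 - 2 : ℝ) = -1 by norm_num, Real.rpow_neg_one, Real.rpow_two]
      simp [div_eq_mul_inv]
    simpa only [hform _ _ (hx _), hform _ _ (hx₁ _), hform _ _ (hx₂ _)] using h
  obtain ⟨μ, hμ⟩ := exists_measure_rpow_mul_rpow_eq_integral hp1 hp2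
  have hsum : ∀ (b : ι → ℝ) (y : κ → ℝ) (n : κ → ι → ℝ), (∀ i, 0 ≤ b i) → (∀ j, 0 < y j) →
      IntegrableOn (fun l => l ^ (p - 2) *
        ∑ j, ∑ i, b i ^ 2 / (1 * b i + l * y j) * n j i) (Ioi 0) μ ∧
      ∑ j, ∑ i, b i ^ p * y j ^ (1 - p) * n j i = ∫ l in Ioi 0, l ^ (p - 2) *
        ∑ j, ∑ i, b i ^ 2 / (1 * b i + l * y j) * n j i ∂μ := by
    intro b y n hb hy
    have e : (fun l : ℝ => l ^ (p - 2) * ∑ j, ∑ i, b i ^ 2 / (1 * b i + l * y j) * n j i) =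
        fun l => ∑ j, ∑ i, l ^ (p - 2) * (b i ^ 2 / (1 * b i + l * y j)) * n j i := by
      ext l; simp only [Finset.mul_sum, mul_assoc]
    have hint : ∀ j i, IntegrableOn
        (fun l => l ^ (p - 2) * (b i ^ 2 / (1 * b i + l * y j)) * n j i) (Ioi 0) μ :=
      fun j i => ((hμ (b i) (y j) (hb i) (hy j)).1).mul_const _
    rw [e]
    refine ⟨integrable_finsetSum _ fun j _ => integrable_finsetSum _ fun i _ => hint j i, ?_⟩
    rw [integral_finsetSum _ fun j _ => integrable_finsetSum _ fun i _ => hint j i]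
    refine Finset.sum_congr rfl fun j _ => ?_
    rw [integral_finsetSum _ fun i _ => hint j i]
    refine Finset.sum_congr rfl fun i _ => ?_
    rw [integral_mul_const, ← (hμ (b i) (y j) (hb i) (hy j)).2]
  obtain ⟨i0, e0⟩ := hsum a x (fun j i => Complex.normSq ((Vᴴ * M * U) j i)) ha hx
  obtain ⟨i1, e1⟩ := hsum a₁ x₁ (fun j i => Complex.normSq ((V₁ᴴ * M * U₁) j i)) ha₁ hx₁
  obtain ⟨i2, e2⟩ := hsum a₂ x₂ (fun j i => Complex.normSq ((V₂ᴴ * M * U₂) j i)) ha₂ hx₂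
  rw [e0, e1, e2, ← integral_const_mul, ← integral_const_mul,
    ← integral_add (i1.const_mul t) (i2.const_mul s)]
  refine setIntegral_mono_on i0 ((i1.const_mul t).add (i2.const_mul s)) measurableSet_Ioi ?_
  intro l hl
  have h := mul_le_mul_of_nonneg_left (key zero_le_one hl)
    (Real.rpow_nonneg (le_of_lt (mem_Ioi.1 hl)) (p - 2))
  refine h.trans (le_of_eq ?_)
  ring

end JointConvexity


section TraceInequalities

variable {ι : Type*} [Fintype ι] [DecidableEq ι]

theorem posDef_spectralMatrix {U : Matrix ι ι ℂ} (hU : U ∈ unitaryGroup ι ℂ) {d : ι → ℝ}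
    (hd : ∀ i, 0 < d i) : (spectralMatrix U d).PosDef := by
  refine (posSemidef_spectralMatrix U fun i => (hd i).le).posDef_iff_isUnit.2 ?_
  refine IsUnit.of_mul_eq_one (spectralMatrix U fun i => (d i)⁻¹) ?_
  rw [spectralMatrix_mul_spectralMatrix hU, ← spectralMatrix_one hU]
  congr 1
  ext i
  exact mul_inv_cancel₀ (hd i).ne'

/-- Scalar inequalities transfer to traces of functions of two Hermitian matrices. -/
theorem trace_spectralMatrix_pair_nonneg {U V : Matrix ι ι ℂ} (hU : U ∈ unitaryGroup ι ℂ)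
    (hV : V ∈ unitaryGroup ι ℂ) (g d f h : ι → ℝ) (b c e : ℝ)
    (hs : ∀ i j, 0 ≤ b * g i + c * (d i * f j) + e * h j) :
    0 ≤ b * (trace (spectralMatrix U g)).re +
      c * (trace (spectralMatrix U d * spectralMatrix V f)).re +
      e * (trace (spectralMatrix V h)).re := by
  have h1 := trace_spectralMatrix_mul_self U V g (fun _ => 1) 1
  have h2 := trace_spectralMatrix_mul_self U V d f 1
  have h3 := trace_spectralMatrix_mul_self U V (fun _ => 1) h 1
  simp only [conjTranspose_one, Matrix.mul_one, spectralMatrix_one hU, spectralMatrix_one hV,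
    Matrix.one_mul] at h1 h2 h3
  rw [h1, h2, h3]
  simp only [Finset.mul_sum, ← Finset.sum_add_distrib]
  refine Finset.sum_nonneg fun j _ => Finset.sum_nonneg fun i _ => ?_
  have := mul_nonneg (hs i j) (Complex.normSq_nonneg ((Vᴴ * U) j i))
  linarith

theorem young_rpow {r z x : ℝ} (hr : 1 ≤ r) (hz : 0 ≤ z) (hx : 0 ≤ x) :
    r * (z * x ^ (r - 1)) ≤ z ^ r + (r - 1) * x ^ r := by
  have hr0 : 0 < r := by linarith
  have h := Real.geom_mean_le_arith_mean2_weighted (w₁ := 1 / r) (w₂ := 1 - 1 / r) (p₁ := z ^ r)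
    (p₂ := x ^ r) (by positivity) (by rw [sub_nonneg, div_le_one hr0]; exact hr)
    (by positivity) (by positivity) (by ring)
  rw [← Real.rpow_mul hz, ← Real.rpow_mul hx, show r * (1 / r) = 1 by field_simp,
    show r * (1 - 1 / r) = r - 1 by field_simp, Real.rpow_one] at h
  have h' := mul_le_mul_of_nonneg_left h hr0.le
  refine h'.trans (le_of_eq ?_)
  field_simp

theorem young_rpow_of_lt_one {r p z w : ℝ} (hr0 : 0 < r) (hr : r < 1) (hz : 0 ≤ z) (hw : 0 < w) :
    z ^ r ≤ r * (z * w ^ (1 - p)) + (1 - r) * w ^ (r * (p - 1) / (1 - r)) := by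
  have hr1 : 0 < 1 - r := by linarith
  have h := Real.geom_mean_le_arith_mean2_weighted (w₁ := r) (w₂ := 1 - r)
    (p₁ := z * w ^ (1 - p)) (p₂ := w ^ (r * (p - 1) / (1 - r))) hr0.le hr1.le
    (by positivity) (by positivity) (by ring)
  refine le_trans (le_of_eq ?_) h
  rw [Real.mul_rpow hz (by positivity), ← Real.rpow_mul hw.le, ← Real.rpow_mul hw.le, mul_assoc,
    ← Real.rpow_add hw, show (1 - p) * r + r * (p - 1) / (1 - r) * (1 - r) = 0 by
      field_simp; ring, Real.rpow_zero, mul_one]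

theorem trace_mul_mrpow_le_s9 {r : ℝ} (hr : 1 ≤ r) {Z X : Matrix ι ι ℂ} (hZ : Z.PosSemidef)
    (hX : X.PosSemidef) :
    r * (trace (Z * mrpow X (r - 1))).re ≤
      (trace (mrpow Z r)).re + (r - 1) * (trace (mrpow X r)).re := by
  obtain ⟨U, hU, z, hz, rfl⟩ := hZ.exists_spectralMatrix
  obtain ⟨V, hV, x, hx, rfl⟩ := hX.exists_spectralMatrix
  simp only [mrpow_spectralMatrix, hU, hV]
  have := trace_spectralMatrix_pair_nonneg hU hV (fun i => z i ^ r) z (fun j => x j ^ (r - 1))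
    (fun j => x j ^ r) 1 (-r) (r - 1) fun i j => by
      have := young_rpow hr (hz i) (hx j)
      linarith
  linarith

theorem trace_mrpow_le_of_lt_one {r p : ℝ} (hr0 : 0 < r) (hr : r < 1) {Z W : Matrix ι ι ℂ}
    (hZ : Z.PosSemidef) (hW : W.PosDef) :
    (trace (mrpow Z r)).re ≤ r * (trace (Z * mrpow W (1 - p))).re +
      (1 - r) * (trace (mrpow W (r * (p - 1) / (1 - r)))).re := by
  obtain ⟨U, hU, z, hz, rfl⟩ := hZ.exists_spectralMatrix
  obtain ⟨V, hV, w, hw, rfl⟩ := hW.exists_spectralMatrix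
  simp only [mrpow_spectralMatrix, hU, hV]
  have := trace_spectralMatrix_pair_nonneg hU hV (fun i => z i ^ r) z (fun j => w j ^ (1 - p))
    (fun j => w j ^ (r * (p - 1) / (1 - r))) (-1) r (1 - r) fun i j => by
      have := young_rpow_of_lt_one (p := p) hr0 hr (hz i) (hw j)
      linarith
  linarith

theorem trace_mul_mrpow_self {r : ℝ} (hr : 0 < r) {X : Matrix ι ι ℂ} (hX : X.PosSemidef) :
    (trace (X * mrpow X (r - 1))).re = (trace (mrpow X r)).re := by
  obtain ⟨U, hU, x, hx, rfl⟩ := hX.exists_spectralMatrix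
  rw [mrpow_spectralMatrix hU, mrpow_spectralMatrix hU, spectralMatrix_mul_spectralMatrix hU]
  congr 3
  ext i
  rw [← Real.rpow_one_add' (hx i) (by linarith)]
  ring_nf

/-- Convexity of `X ↦ Tr X ^ r` for `r ≥ 1`. -/
theorem trace_mrpow_convex {r : ℝ} (hr : 1 ≤ r) {X₁ X₂ : Matrix ι ι ℂ} (hX₁ : X₁.PosSemidef)
    (hX₂ : X₂.PosSemidef) {t s : ℝ} (ht : 0 ≤ t) (hs : 0 ≤ s) (hts : t + s = 1) :
    (trace (mrpow (t • X₁ + s • X₂) r)).re ≤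
      t * (trace (mrpow X₁ r)).re + s * (trace (mrpow X₂ r)).re := by
  have hX : (t • X₁ + s • X₂).PosSemidef := (hX₁.smul ht).add (hX₂.smul hs)
  have h0 := trace_mul_mrpow_self (by linarith : 0 < r) hX
  have h1 := mul_le_mul_of_nonneg_left (trace_mul_mrpow_le_s9 hr hX₁ hX) ht
  have h2 := mul_le_mul_of_nonneg_left (trace_mul_mrpow_le_s9 hr hX₂ hX) hs
  generalize hB : mrpow (t • X₁ + s • X₂) (r - 1) = B at *
  simp only [Matrix.add_mul, Matrix.smul_mul, trace_add, trace_smul, Complex.add_re,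
    Complex.smul_re, smul_eq_mul] at h0
  obtain rfl : s = 1 - t := by linarith
  linear_combination h1 + h2 - r * h0

end TraceInequalities

section PartialTrace

variable {k l : Type*} [Fintype k] [DecidableEq k] [Fintype l] [DecidableEq l]

omit [Fintype k] [DecidableEq k] [DecidableEq l] in
theorem posSemidef_ptrace2 {Y : Matrix (k × l) (k × l) ℂ} (hY : Y.PosSemidef) :
    (ptrace2 Y).PosSemidef := by
  have h : ptrace2 Y = ∑ j : l, Y.submatrix (fun i => (i, j)) (fun i => (i, j)) := by
    ext i i'
    simp [ptrace2, Matrix.sum_apply]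
  rw [h]
  exact posSemidef_sum _ fun j _ => hY.submatrix _

omit [DecidableEq k] in
theorem trace_ptrace2_mul (Y : Matrix (k × l) (k × l) ℂ) (K : Matrix k k ℂ) :
    trace (ptrace2 Y * K) = trace (Y * (K ⊗ₖ (1 : Matrix l l ℂ))) := by
  simp only [trace, diag_apply, mul_apply, ptrace2, Fintype.sum_prod_type, kroneckerMap_apply,
    one_apply, mul_ite, mul_one, mul_zero, Finset.sum_ite_eq', Finset.mem_univ, if_true,
    Finset.sum_mul]
  refine Finset.sum_congr rfl fun i _ => ?_
  rw [Finset.sum_comm]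

omit [Fintype k] [DecidableEq k] [DecidableEq l] in
theorem ptrace2_smul (c : ℝ) (Y : Matrix (k × l) (k × l) ℂ) :
    ptrace2 (c • Y) = c • ptrace2 Y := by
  ext i i'
  simp [ptrace2, Finset.mul_sum]

theorem mrpow_kronecker_one {W : Matrix k k ℂ} (hW : W.PosSemidef) (e : ℝ) :
    mrpow (W ⊗ₖ (1 : Matrix l l ℂ)) e = mrpow W e ⊗ₖ (1 : Matrix l l ℂ) := by
  obtain ⟨U, hU, d, hd, rfl⟩ := hW.exists_spectralMatrix
  have h : ∀ f : k → ℝ, spectralMatrix U f ⊗ₖ (1 : Matrix l l ℂ) =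
      spectralMatrix (U ⊗ₖ (1 : Matrix l l ℂ)) (fun x => f x.1) := by
    intro f
    have hd : diagonal (fun x : k × l => (f x.1 : ℂ)) =
        diagonal (fun i => (f i : ℂ)) ⊗ₖ (1 : Matrix l l ℂ) := by
      rw [← diagonal_one, diagonal_kronecker_diagonal]
      simp
    rw [spectralMatrix, spectralMatrix, hd, conjTranspose_kronecker, conjTranspose_one,
      ← mul_kronecker_mul, ← mul_kronecker_mul]
    simp
  rw [h, mrpow_spectralMatrix hU, mrpow_spectralMatrix (kronecker_mem_unitary hU (one_mem _)), h]

/-- `Tr₁ (Tr₂ A ^ p) ^ (q / p)` is convex in `A ≥ 0` when `1 ≤ p ≤ 2` and `p ≤ q`. -/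
theorem trace_mrpow_ptrace2_convex_of_le {p q : ℝ} (hp1 : 1 ≤ p) (hp2 : p ≤ 2) (hpq : p ≤ q)
    {A₁ A₂ : Matrix (k × l) (k × l) ℂ} (hA₁ : A₁.PosSemidef) (hA₂ : A₂.PosSemidef)
    {t s : ℝ} (ht : 0 ≤ t) (hs : 0 ≤ s) (hts : t + s = 1) :
    (trace (mrpow (ptrace2 (mrpow (t • A₁ + s • A₂) p)) (q / p))).re ≤
      t * (trace (mrpow (ptrace2 (mrpow A₁ p)) (q / p))).re +
      s * (trace (mrpow (ptrace2 (mrpow A₂ p)) (q / p))).re := by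
  have hA : (t • A₁ + s • A₂).PosSemidef := (hA₁.smul ht).add (hA₂.smul hs)
  have hr : 1 ≤ q / p := by rw [le_div_iff₀ (by linarith)]; linarith
  generalize q / p = r at *
  have hZ := posSemidef_ptrace2 (posSemidef_mrpow hA p)
  have hZ₁ := posSemidef_ptrace2 (posSemidef_mrpow hA₁ p)
  have hZ₂ := posSemidef_ptrace2 (posSemidef_mrpow hA₂ p)
  have h0 := trace_mul_mrpow_self (by linarith : 0 < r) hZ
  have h1 := mul_le_mul_of_nonneg_left (trace_mul_mrpow_le_s9 hr hZ₁ hZ) ht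
  have h2 := mul_le_mul_of_nonneg_left (trace_mul_mrpow_le_s9 hr hZ₂ hZ) hs
  have hc := trace_mrpow_mul_mrpow_convex hp1 hp2
    (mrpow (ptrace2 (mrpow (t • A₁ + s • A₂) p)) ((r - 1) / 2) ⊗ₖ (1 : Matrix l l ℂ))
    hA₁ hA₂ PosDef.one PosDef.one ht hs hts
  rw [← add_smul, hts, one_smul, one_mrpow] at hc
  simp only [Matrix.mul_one] at hc
  simp only [Matrix.mul_assoc, conjTranspose_kronecker, conjTranspose_one, ← mul_kronecker_mul,
    mrpow_half_mul_self hZ, Matrix.mul_one, ← trace_ptrace2_mul] at hc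
  obtain rfl : s = 1 - t := by linarith
  have := mul_le_mul_of_nonneg_left hc (by linarith : 0 ≤ r)
  linear_combination h1 + h2 + this - r * h0

open Filter Topology in
/-- `Tr₁ (Tr₂ A ^ p) ^ (q / p)` is convex in `A ≥ 0` when `1 ≤ q < p ≤ 2`. -/
theorem trace_mrpow_ptrace2_convex_of_lt {p q : ℝ} (hp2 : p ≤ 2) (hq : 1 ≤ q) (hpq : q < p)
    {A₁ A₂ : Matrix (k × l) (k × l) ℂ} (hA₁ : A₁.PosSemidef) (hA₂ : A₂.PosSemidef)
    {t s : ℝ} (ht : 0 ≤ t) (hs : 0 ≤ s) (hts : t + s = 1) :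
    (trace (mrpow (ptrace2 (mrpow (t • A₁ + s • A₂) p)) (q / p))).re ≤
      t * (trace (mrpow (ptrace2 (mrpow A₁ p)) (q / p))).re +
      s * (trace (mrpow (ptrace2 (mrpow A₂ p)) (q / p))).re := by
  have hp0 : 0 < p := by linarith
  have hp1 : 0 < p - 1 := by linarith
  have hA : (t • A₁ + s • A₂).PosSemidef := (hA₁.smul ht).add (hA₂.smul hs)
  have hr : q / p < 1 := by rw [div_lt_one hp0]; exact hpq
  have hr0 : 0 < q / p := by positivity
  have hrp : q / p * p = q := by field_simp
  generalize q / p = r at *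
  have hr1 : 0 < 1 - r := by linarith
  have hu : 1 ≤ r * (p - 1) / (1 - r) := by
    rw [le_div_iff₀ hr1]; linarith
  have hZ := posSemidef_ptrace2 (posSemidef_mrpow hA p)
  have hZ₁ := posSemidef_ptrace2 (posSemidef_mrpow hA₁ p)
  have hZ₂ := posSemidef_ptrace2 (posSemidef_mrpow hA₂ p)
  obtain ⟨V₁, hV₁, z₁, hz₁, hZe₁⟩ := hZ₁.exists_spectralMatrix
  obtain ⟨V₂, hV₂, z₂, hz₂, hZe₂⟩ := hZ₂.exists_spectralMatrix
  rw [hZe₁, hZe₂, mrpow_spectralMatrix hV₁, mrpow_spectralMatrix hV₂, trace_spectralMatrix hV₁,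
    trace_spectralMatrix hV₂]
  have hbound : ∀ ε : ℝ, 0 < ε → ∀ (V : Matrix k k ℂ) (z : k → ℝ), V ∈ unitaryGroup k ℂ →
      (∀ i, 0 ≤ z i) → ∃ W : Matrix k k ℂ, W.PosDef ∧
      r * (trace (spectralMatrix V z * mrpow W (1 - p))).re +
      (1 - r) * (trace (mrpow W (r * (p - 1) / (1 - r)))).re ≤ ∑ i, (z i + ε) ^ r := by
    intro ε hε V z hV hz
    have hzε : ∀ i, 0 < z i + ε := fun i => add_pos_of_nonneg_of_pos (hz i) hε
    refine ⟨spectralMatrix V fun i => (z i + ε) ^ ((1 - r) / (p - 1)),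
      posDef_spectralMatrix hV fun i => Real.rpow_pos_of_pos (hzε i) _, ?_⟩
    rw [mrpow_spectralMatrix hV, mrpow_spectralMatrix hV, spectralMatrix_mul_spectralMatrix hV,
      trace_spectralMatrix hV, trace_spectralMatrix hV, Finset.mul_sum, Finset.mul_sum,
      ← Finset.sum_add_distrib]
    refine Finset.sum_le_sum fun i _ => ?_
    rw [← Real.rpow_mul (hzε i).le, ← Real.rpow_mul (hzε i).le,
      show (1 - r) / (p - 1) * (1 - p) = r - 1 by field_simp; ring,
      show (1 - r) / (p - 1) * (r * (p - 1) / (1 - r)) = r by field_simp]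
    have h1 : z i * (z i + ε) ^ (r - 1) ≤ (z i + ε) ^ r := by
      calc z i * (z i + ε) ^ (r - 1) ≤ (z i + ε) * (z i + ε) ^ (r - 1) :=
            mul_le_mul_of_nonneg_right (by linarith) (Real.rpow_nonneg (hzε i).le _)
        _ = (z i + ε) ^ r := by
            rw [← Real.rpow_one_add' (hzε i).le (by linarith)]; ring_nf
    have := mul_le_mul_of_nonneg_left h1 hr0.le
    linarith
  have hlim : Tendsto (fun ε : ℝ => t * ∑ i, (z₁ i + ε) ^ r + s * ∑ i, (z₂ i + ε) ^ r)
      (𝓝[>] 0) (𝓝 (t * ∑ i, z₁ i ^ r + s * ∑ i, z₂ i ^ r)) := by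
    have hc : Continuous (fun ε : ℝ => t * ∑ i, (z₁ i + ε) ^ r + s * ∑ i, (z₂ i + ε) ^ r) := by
      have : ∀ a : ℝ, Continuous fun ε : ℝ => (a + ε) ^ r := fun a =>
        (continuous_const.add continuous_id).rpow_const fun _ => Or.inr hr0.le
      fun_prop
    have := (hc.tendsto 0).mono_left (nhdsWithin_le_nhds (s := Set.Ioi 0))
    simpa using this
  refine ge_of_tendsto hlim ?_
  filter_upwards [self_mem_nhdsWithin] with ε hε
  obtain ⟨W₁, hW₁, hb₁⟩ := hbound ε hε V₁ z₁ hV₁ hz₁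
  obtain ⟨W₂, hW₂, hb₂⟩ := hbound ε hε V₂ z₂ hV₂ hz₂
  rw [← hZe₁] at hb₁
  rw [← hZe₂] at hb₂
  have hW : (t • W₁ + s • W₂).PosDef := by
    rcases ht.eq_or_lt with rfl | ht
    · obtain rfl : s = 1 := by linarith
      simpa using hW₂
    · exact (hW₁.smul ht).add_posSemidef (hW₂.posSemidef.smul hs)
  have h0 := trace_mrpow_le_of_lt_one (p := p) hr0 hr hZ hW
  have hcW := trace_mrpow_convex hu hW₁.posSemidef hW₂.posSemidef ht hs hts
  have hc := trace_mrpow_mul_mrpow_convex (by linarith) hp2 1 hA₁ hA₂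
    (hW₁.kronecker (PosDef.one (n := l))) (hW₂.kronecker (PosDef.one (n := l))) ht hs hts
  rw [← smul_kronecker, ← smul_kronecker, ← add_kronecker, mrpow_kronecker_one hW.posSemidef,
    mrpow_kronecker_one hW₁.posSemidef, mrpow_kronecker_one hW₂.posSemidef] at hc
  simp only [conjTranspose_one, Matrix.mul_one, ← trace_ptrace2_mul] at hc
  have g1 := mul_le_mul_of_nonneg_left hb₁ ht
  have g2 := mul_le_mul_of_nonneg_left hb₂ hs
  have g3 := mul_le_mul_of_nonneg_left hc hr0.le
  have g4 := mul_le_mul_of_nonneg_left hcW hr1.le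
  linear_combination h0 + g1 + g2 + g3 + g4

end PartialTrace


section Psi

variable {k l : Type*} [Fintype k] [DecidableEq k] [Fintype l] [DecidableEq l]

theorem trace_mrpow_ptrace2_nonneg (p e : ℝ) {A : Matrix (k × l) (k × l) ℂ}
    (hA : A.PosSemidef) : 0 ≤ (trace (mrpow (ptrace2 (mrpow A p)) e)).re :=
  (Complex.le_def.1 (posSemidef_mrpow
    (posSemidef_ptrace2 (posSemidef_mrpow hA p)) e).trace_nonneg).1

theorem trace_mrpow_ptrace2_smul {p q : ℝ} (hp : 0 < p) {A : Matrix (k × l) (k × l) ℂ}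
    (hA : A.PosSemidef) {c : ℝ} (hc : 0 ≤ c) :
    (trace (mrpow (ptrace2 (mrpow (c • A) p)) (q / p))).re =
      c ^ q * (trace (mrpow (ptrace2 (mrpow A p)) (q / p))).re := by
  rw [mrpow_smul hA hc, ptrace2_smul, mrpow_smul (posSemidef_ptrace2 (posSemidef_mrpow hA p))
    (Real.rpow_nonneg hc p), ← Real.rpow_mul hc, mul_div_cancel₀ _ hp.ne', trace_smul,
    Complex.smul_re, smul_eq_mul]

theorem Psi_smul {p q : ℝ} (hp : 0 < p) (hq : 0 < q) {A : Matrix (k × l) (k × l) ℂ}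
    (hA : A.PosSemidef) {c : ℝ} (hc : 0 ≤ c) : Psi p q (c • A) = c * Psi p q A := by
  rw [Psi, trace_mrpow_ptrace2_smul hp hA hc, Real.mul_rpow (Real.rpow_nonneg hc q)
    (trace_mrpow_ptrace2_nonneg p _ hA), ← Real.rpow_mul hc, mul_one_div_cancel hq.ne',
    Real.rpow_one, Psi]

/-- `Ψ_{p,q}` is subadditive on positive semidefinite matrices for `1 ≤ p ≤ 2`, `q ≥ 1`. -/
theorem Psi_add_le {p q : ℝ} (hp1 : 1 ≤ p) (hp2 : p ≤ 2) (hq : 1 ≤ q)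
    {A B : Matrix (k × l) (k × l) ℂ} (hA : A.PosSemidef) (hB : B.PosSemidef) :
    Psi p q (A + B) ≤ Psi p q A + Psi p q B := by
  have hp0 : 0 < p := by linarith
  have hq0 : 0 < q := by linarith
  have hunit : ∀ {C : Matrix (k × l) (k × l) ℂ}, C.PosSemidef → ∀ {α : ℝ}, Psi p q C < α →
      (trace (mrpow (ptrace2 (mrpow (α⁻¹ • C) p)) (q / p))).re ≤ 1 := by
    intro C hC α hα
    have hα0 : 0 < α := (Psi_nonneg p q hC).trans_lt hα
    rw [trace_mrpow_ptrace2_smul hp0 hC (inv_nonneg.2 hα0.le), Real.inv_rpow hα0.le,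
      inv_mul_le_iff₀ (Real.rpow_pos_of_pos hα0 q), mul_one]
    rw [Psi, one_div] at hα
    exact (Real.rpow_inv_le_iff_of_pos (trace_mrpow_ptrace2_nonneg p _ hC) hα0.le hq0).1 hα.le
  refine le_of_forall_pos_le_add fun ε hε => ?_
  have hαA : Psi p q A < Psi p q A + ε / 2 := by linarith
  have hβB : Psi p q B < Psi p q B + ε / 2 := by linarith
  have hα0 : 0 < Psi p q A + ε / 2 := (Psi_nonneg p q hA).trans_lt hαA
  have hβ0 : 0 < Psi p q B + ε / 2 := (Psi_nonneg p q hB).trans_lt hβB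
  have hsum : Psi p q A + Psi p q B + ε = (Psi p q A + ε / 2) + (Psi p q B + ε / 2) := by ring
  have hTA := hunit hA hαA
  have hTB := hunit hB hβB
  rw [hsum]
  generalize Psi p q A + ε / 2 = α at *
  generalize Psi p q B + ε / 2 = β at *
  have hαβ : 0 < α + β := add_pos hα0 hβ0
  have hA' : (α⁻¹ • A).PosSemidef := hA.smul (inv_nonneg.2 hα0.le)
  have hB' : (β⁻¹ • B).PosSemidef := hB.smul (inv_nonneg.2 hβ0.le)
  have ht : 0 ≤ α / (α + β) := by positivity
  have hs : 0 ≤ β / (α + β) := by positivity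
  have hts : α / (α + β) + β / (α + β) = 1 := by field_simp
  have hC : ((α / (α + β)) • α⁻¹ • A + (β / (α + β)) • β⁻¹ • B).PosSemidef :=
    (hA'.smul ht).add (hB'.smul hs)
  have hAB : A + B = (α + β) • ((α / (α + β)) • α⁻¹ • A + (β / (α + β)) • β⁻¹ • B) := by
    rw [smul_add, smul_smul, smul_smul, smul_smul, smul_smul,
      show (α + β) * (α / (α + β)) * α⁻¹ = 1 by field_simp,
      show (α + β) * (β / (α + β)) * β⁻¹ = 1 by field_simp, one_smul, one_smul]
  have hT := (le_or_gt p q).elim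
    (fun h => trace_mrpow_ptrace2_convex_of_le hp1 hp2 h hA' hB' ht hs hts)
    (fun h => trace_mrpow_ptrace2_convex_of_lt hp2 hq h hA' hB' ht hs hts)
  have hT1 := hT.trans (add_le_add (mul_le_mul_of_nonneg_left hTA ht)
    (mul_le_mul_of_nonneg_left hTB hs))
  rw [mul_one, mul_one, hts] at hT1
  rw [hAB, Psi_smul hp0 hq0 hC hαβ.le]
  refine mul_le_of_le_one_right hαβ.le ?_
  exact Real.rpow_le_one (trace_mrpow_ptrace2_nonneg p _ hC) hT1 (by positivity)

omit [DecidableEq l] in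
theorem one_kronecker_conj_apply (u : Matrix l l ℂ) (M : Matrix (k × l) (k × l) ℂ) (i i' : k)
    (j j' : l) :
    (((1 : Matrix k k ℂ) ⊗ₖ u) * M * ((1 : Matrix k k ℂ) ⊗ₖ u)ᴴ) (i, j) (i', j') =
      (u * M.submatrix (fun j => (i, j)) (fun j => (i', j)) * uᴴ) j j' := by
  simp only [mul_apply, Fintype.sum_prod_type, kroneckerMap_apply, conjTranspose_apply, one_apply,
    submatrix_apply, ite_mul, one_mul, zero_mul, apply_ite star, star_zero,
    mul_ite, mul_zero]
  rw [Finset.sum_eq_single i' (fun b _ hb => Finset.sum_eq_zero fun x _ => if_neg (Ne.symm hb))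
    (by simp)]
  refine Finset.sum_congr rfl fun x _ => ?_
  rw [if_pos rfl]
  congr 1
  rw [Finset.sum_eq_single i (fun b _ hb => Finset.sum_eq_zero fun x _ => if_neg (Ne.symm hb))
    (by simp)]
  simp

theorem ptrace2_one_kronecker_conj {u : Matrix l l ℂ} (hu : u ∈ unitaryGroup l ℂ)
    (M : Matrix (k × l) (k × l) ℂ) :
    ptrace2 (((1 : Matrix k k ℂ) ⊗ₖ u) * M * ((1 : Matrix k k ℂ) ⊗ₖ u)ᴴ) = ptrace2 M := by
  ext i i'
  simp only [ptrace2, one_kronecker_conj_apply]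
  change trace (u * M.submatrix (fun j => (i, j)) (fun j => (i', j)) * uᴴ) = _
  rw [trace_mul_comm, ← Matrix.mul_assoc, conjTranspose_mul_self_of_mem_unitaryGroup hu,
    Matrix.one_mul]
  rfl

theorem Psi_one_kronecker_conj (p q : ℝ) {u : Matrix l l ℂ} (hu : u ∈ unitaryGroup l ℂ)
    {A : Matrix (k × l) (k × l) ℂ} (hA : A.PosSemidef) :
    Psi p q (((1 : Matrix k k ℂ) ⊗ₖ u) * A * ((1 : Matrix k k ℂ) ⊗ₖ u)ᴴ) = Psi p q A := by
  rw [Psi, mrpow_unitary_conj hA (kronecker_mem_unitary (one_mem _) hu),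
    ptrace2_one_kronecker_conj hu, Psi]

end Psi

section QubitConjugation

variable {k l : Type*} [Fintype k] [DecidableEq k] [Fintype l] [DecidableEq l]

/-- Conjugation of a matrix in `M_k ⊗ (M_l ⊗ M_2)` by `1 ⊗ (1 ⊗ v)`. -/
noncomputable def qubitConj (v : Matrix (Fin 2) (Fin 2) ℂ)
    (A : Matrix (k × (l × Fin 2)) (k × (l × Fin 2)) ℂ) :
    Matrix (k × (l × Fin 2)) (k × (l × Fin 2)) ℂ :=
  ((1 : Matrix k k ℂ) ⊗ₖ ((1 : Matrix l l ℂ) ⊗ₖ v)) * A *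
    ((1 : Matrix k k ℂ) ⊗ₖ ((1 : Matrix l l ℂ) ⊗ₖ v))ᴴ

theorem qubitConj_apply (v : Matrix (Fin 2) (Fin 2) ℂ)
    (A : Matrix (k × (l × Fin 2)) (k × (l × Fin 2)) ℂ) (i i' : k) (j j' : l) (c c' : Fin 2) :
    qubitConj v A (i, (j, c)) (i', (j', c')) =
      ∑ d', (∑ d, v c d * A (i, (j, d)) (i', (j', d'))) * star (v c' d') := by
  rw [qubitConj, one_kronecker_conj_apply, one_kronecker_conj_apply]
  simp [mul_apply]

theorem qubitConj_add (v : Matrix (Fin 2) (Fin 2) ℂ)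
    (A B : Matrix (k × (l × Fin 2)) (k × (l × Fin 2)) ℂ) :
    qubitConj v (A + B) = qubitConj v A + qubitConj v B := by
  simp only [qubitConj, Matrix.mul_add, Matrix.add_mul]

theorem qubitConj_qubitConj (v w : Matrix (Fin 2) (Fin 2) ℂ)
    (A : Matrix (k × (l × Fin 2)) (k × (l × Fin 2)) ℂ) :
    qubitConj v (qubitConj w A) = qubitConj (v * w) A := by
  have h : (1 : Matrix k k ℂ) ⊗ₖ ((1 : Matrix l l ℂ) ⊗ₖ (v * w)) =
      ((1 : Matrix k k ℂ) ⊗ₖ ((1 : Matrix l l ℂ) ⊗ₖ v)) *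
        ((1 : Matrix k k ℂ) ⊗ₖ ((1 : Matrix l l ℂ) ⊗ₖ w)) := by
    rw [← mul_kronecker_mul, ← mul_kronecker_mul, Matrix.one_mul, Matrix.one_mul]
  rw [qubitConj, qubitConj, qubitConj, h, conjTranspose_mul]
  simp only [Matrix.mul_assoc]

theorem qubitConj_one (A : Matrix (k × (l × Fin 2)) (k × (l × Fin 2)) ℂ) :
    qubitConj 1 A = A := by
  simp [qubitConj]

theorem posSemidef_qubitConj (v : Matrix (Fin 2) (Fin 2) ℂ)
    {A : Matrix (k × (l × Fin 2)) (k × (l × Fin 2)) ℂ} (hA : A.PosSemidef) :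
    (qubitConj v A).PosSemidef :=
  hA.mul_mul_conjTranspose_same _

theorem Psi_qubitConj (p q : ℝ) {v : Matrix (Fin 2) (Fin 2) ℂ}
    (hv : v ∈ unitaryGroup (Fin 2) ℂ) {A : Matrix (k × (l × Fin 2)) (k × (l × Fin 2)) ℂ}
    (hA : A.PosSemidef) : Psi p q (qubitConj v A) = Psi p q A :=
  Psi_one_kronecker_conj p q (kronecker_mem_unitary (one_mem _) hv) hA

/-- The `2 × 2` Hadamard matrix. -/
noncomputable def hadamardTwo : Matrix (Fin 2) (Fin 2) ℂ :=
  (((√2)⁻¹ : ℝ) : ℂ) • !![1, 1; 1, -1]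

theorem hadamardTwo_mul_self : hadamardTwo * hadamardTwo = 1 := by
  have h : (((√2)⁻¹ : ℝ) : ℂ) * (((√2)⁻¹ : ℝ) : ℂ) = 1 / 2 := by
    rw [← Complex.ofReal_mul, ← mul_inv, Real.mul_self_sqrt (by norm_num)]
    norm_num
  rw [hadamardTwo, Matrix.smul_mul, Matrix.mul_smul, smul_smul, h]
  ext i j
  fin_cases i <;> fin_cases j <;> simp [mul_apply, Fin.sum_univ_two] <;> norm_num

theorem hadamardTwo_mem_unitaryGroup : hadamardTwo ∈ unitaryGroup (Fin 2) ℂ := by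
  have h : star hadamardTwo = hadamardTwo := by
    ext i j
    fin_cases i <;> fin_cases j <;> simp [hadamardTwo, star_apply]
  rw [mem_unitaryGroup_iff, h, hadamardTwo_mul_self]

theorem qubitConj_hadamardTwo_blockDiag2 {Y : Matrix (k × l) (k × l) ℂ} (hY : Y.IsHermitian) :
    qubitConj hadamardTwo (blockDiag2 Y (-Y)) = clBlock Y := by
  have h : (((√2)⁻¹ : ℝ) : ℂ) * (((√2)⁻¹ : ℝ) : ℂ) = 1 / 2 := by
    rw [← Complex.ofReal_mul, ← mul_inv, Real.mul_self_sqrt (by norm_num)]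
    norm_num
  ext ⟨i, j, c⟩ ⟨i', j', c'⟩
  have hYij : (starRingEnd ℂ) (Y (i', j') (i, j)) = Y (i, j) (i', j') := hY.apply _ _
  rw [qubitConj_apply]
  unfold hadamardTwo
  generalize (((√2)⁻¹ : ℝ)) = r at h
  fin_cases c <;> fin_cases c' <;>
    simp [blockDiag2, clBlock, Fin.sum_univ_two, hYij] <;>
    linear_combination 2 * Y (i, j) (i', j') * h

theorem posSemidef_blockDiag2 {P Q : Matrix (k × l) (k × l) ℂ} (hP : P.PosSemidef)
    (hQ : Q.PosSemidef) : (blockDiag2 P Q).PosSemidef := by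
  have h : blockDiag2 P Q =
      qubitConj !![1, 0; 0, 0] (P.submatrix (fun x => (x.1, x.2.1)) (fun x => (x.1, x.2.1))) +
      qubitConj !![0, 0; 0, 1]
        (Q.submatrix (fun x => (x.1, x.2.1)) (fun x => (x.1, x.2.1))) := by
    ext ⟨i, j, c⟩ ⟨i', j', c'⟩
    rw [Matrix.add_apply, qubitConj_apply, qubitConj_apply]
    fin_cases c <;> fin_cases c' <;> simp [blockDiag2, Fin.sum_univ_two]
  rw [h]
  exact (posSemidef_qubitConj _ (hP.submatrix _)).add (posSemidef_qubitConj _ (hQ.submatrix _))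

theorem pauliX_mem_unitaryGroup :
    (!![0, 1; 1, 0] : Matrix (Fin 2) (Fin 2) ℂ) ∈ unitaryGroup (Fin 2) ℂ := by
  rw [mem_unitaryGroup_iff]
  ext i j
  fin_cases i <;> fin_cases j <;> simp [mul_apply, Fin.sum_univ_two, star_apply]

theorem pauliZ_mem_unitaryGroup :
    (!![1, 0; 0, -1] : Matrix (Fin 2) (Fin 2) ℂ) ∈ unitaryGroup (Fin 2) ℂ := by
  rw [mem_unitaryGroup_iff]
  ext i j
  fin_cases i <;> fin_cases j <;> simp [mul_apply, Fin.sum_univ_two, star_apply]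

theorem Psi_blockDiag2_swap (p q : ℝ) {P Q : Matrix (k × l) (k × l) ℂ} (hP : P.PosSemidef)
    (hQ : Q.PosSemidef) : Psi p q (blockDiag2 Q P) = Psi p q (blockDiag2 P Q) := by
  rw [← Psi_qubitConj p q pauliX_mem_unitaryGroup (posSemidef_blockDiag2 hP hQ)]
  congr 1
  ext ⟨i, j, c⟩ ⟨i', j', c'⟩
  rw [qubitConj_apply]
  fin_cases c <;> fin_cases c' <;> simp [blockDiag2, Fin.sum_univ_two]

/-- The diagonal block of index `c` of a matrix in `M_k ⊗ (M_l ⊗ M_2)`. -/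
def qubitBlock (c : Fin 2) (A : Matrix (k × (l × Fin 2)) (k × (l × Fin 2)) ℂ) :
    Matrix (k × l) (k × l) ℂ :=
  A.submatrix (fun x => (x.1, (x.2, c))) (fun x => (x.1, (x.2, c)))

theorem Psi_blockDiag2_average_le {p q : ℝ} (hp1 : 1 ≤ p) (hp2 : p ≤ 2) (hq : 1 ≤ q)
    {A B : Matrix (k × (l × Fin 2)) (k × (l × Fin 2)) ℂ} (hA : A.PosSemidef)
    (hB : B.PosSemidef) :
    Psi p q (blockDiag2 ((1 / 2 : ℝ) • (qubitBlock 0 B + qubitBlock 1 A))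
      ((1 / 2 : ℝ) • (qubitBlock 0 A + qubitBlock 1 B))) ≤ (Psi p q A + Psi p q B) / 2 := by
  have hX := pauliX_mem_unitaryGroup
  have hZ := pauliZ_mem_unitaryGroup
  have h : blockDiag2 ((1 / 2 : ℝ) • (qubitBlock 0 B + qubitBlock 1 A))
      ((1 / 2 : ℝ) • (qubitBlock 0 A + qubitBlock 1 B)) =
      (1 / 4 : ℝ) • ((B + qubitConj !![1, 0; 0, -1] B) + (qubitConj !![0, 1; 1, 0] A +
        qubitConj (!![0, 1; 1, 0] * !![1, 0; 0, -1]) A)) := by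
    ext ⟨i, j, c⟩ ⟨i', j', c'⟩
    rw [Matrix.smul_apply, Matrix.add_apply, Matrix.add_apply, Matrix.add_apply,
      qubitConj_apply, qubitConj_apply, qubitConj_apply]
    fin_cases c <;> fin_cases c' <;>
      simp [blockDiag2, Fin.sum_univ_two, mul_apply, qubitBlock] <;> ring
  have h1 := posSemidef_qubitConj !![1, 0; 0, -1] hB
  have h2 := posSemidef_qubitConj !![0, 1; 1, 0] hA
  have h3 := posSemidef_qubitConj (!![0, 1; 1, 0] * !![1, 0; 0, -1]) hA
  rw [h, Psi_smul (by linarith) (by linarith) ((hB.add h1).add (h2.add h3)) (by norm_num)]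
  have e0 := Psi_add_le hp1 hp2 hq (hB.add h1) (h2.add h3)
  have e1 := Psi_add_le hp1 hp2 hq hB h1
  have e2 := Psi_add_le hp1 hp2 hq h2 h3
  rw [Psi_qubitConj p q hZ hB] at e1
  rw [Psi_qubitConj p q hX hA, Psi_qubitConj p q (mul_mem hX hZ) hA] at e2
  linarith

end QubitConjugation


/-- **Representation of the Carlen–Lieb norm of a Hermitian matrix**:
`‖Y‖_CL = inf { Ψ_{p,q}(diag(Y + A, A)) : A ≥ 0, Y + A ≥ 0 }`. -/
theorem clNorm_hermitian_representation {n m : ℕ} (hn : 0 < n) (hm : 0 < m) (p q : ℝ)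
    (hp1 : 1 ≤ p) (hp2 : p ≤ 2) (hq : 1 ≤ q)
    (Y : Matrix (Fin n × Fin m) (Fin n × Fin m) ℂ) (hY : Y.IsHermitian) :
    clNorm p q Y = sInf { s : ℝ | ∃ A : Matrix (Fin n × Fin m) (Fin n × Fin m) ℂ,
      A.PosSemidef ∧ (Y + A).PosSemidef ∧ s = Psi p q (blockDiag2 (Y + A) A) } := by
  classical
  set S := { s : ℝ | ∃ A : Matrix (Fin n × Fin m) (Fin n × Fin m) ℂ,
      A.PosSemidef ∧ (Y + A).PosSemidef ∧ s = Psi p q (blockDiag2 (Y + A) A) } with hS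
  set T := { s : ℝ | ∃ A B : Matrix (Fin n × (Fin m × Fin 2)) (Fin n × (Fin m × Fin 2)) ℂ,
    A.PosSemidef ∧ B.PosSemidef ∧ clBlock Y + A = B ∧ s = Psi p q A + Psi p q B } with hT
  have hST : ∀ s ∈ S, 2 * s ∈ T := by
    rintro s ⟨A, hA, hYA, rfl⟩
    have hAY' := posSemidef_blockDiag2 hA hYA
    have hYA' := posSemidef_blockDiag2 hYA hA
    refine ⟨_, _, posSemidef_qubitConj hadamardTwo hAY', posSemidef_qubitConj hadamardTwo hYA',
      ?_, ?_⟩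
    · rw [← qubitConj_hadamardTwo_blockDiag2 hY, ← qubitConj_add]
      congr 1
      ext ⟨i, j, c⟩ ⟨i', j', c'⟩
      fin_cases c <;> fin_cases c' <;> simp [blockDiag2]
    · rw [Psi_qubitConj p q hadamardTwo_mem_unitaryGroup hAY',
        Psi_qubitConj p q hadamardTwo_mem_unitaryGroup hYA', Psi_blockDiag2_swap p q hYA hA]
      ring
  have hTS : ∀ s ∈ T, ∃ s' ∈ S, s' ≤ s / 2 := by
    rintro s ⟨A, B, hA, hB, hAB, rfl⟩
    have hA' := posSemidef_qubitConj hadamardTwo hA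
    have hB' := posSemidef_qubitConj hadamardTwo hB
    have hAB' : blockDiag2 Y (-Y) + qubitConj hadamardTwo A = qubitConj hadamardTwo B := by
      rw [← hAB, qubitConj_add, ← qubitConj_hadamardTwo_blockDiag2 hY, qubitConj_qubitConj,
        hadamardTwo_mul_self, qubitConj_one]
    have hle := Psi_blockDiag2_average_le hp1 hp2 hq hA' hB'
    rw [Psi_qubitConj p q hadamardTwo_mem_unitaryGroup hA,
      Psi_qubitConj p q hadamardTwo_mem_unitaryGroup hB] at hle
    generalize qubitConj hadamardTwo A = A' at *
    generalize qubitConj hadamardTwo B = B' at *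
    have hY' : Y + (1 / 2 : ℝ) • (qubitBlock 0 A' + qubitBlock 1 B') =
        (1 / 2 : ℝ) • (qubitBlock 0 B' + qubitBlock 1 A') := by
      subst hAB'
      ext ⟨i, j⟩ ⟨i', j'⟩
      simp [qubitBlock, blockDiag2]
      ring
    refine ⟨_, ⟨(1 / 2 : ℝ) • (qubitBlock 0 A' + qubitBlock 1 B'), ?_, ?_, rfl⟩, ?_⟩
    · exact ((hA'.submatrix _).add (hB'.submatrix _)).smul (by norm_num)
    · rw [hY']
      exact ((hB'.submatrix _).add (hA'.submatrix _)).smul (by norm_num)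
    · rw [hY']
      exact hle
  have hS0 : BddBelow S := ⟨0, by
    rintro s ⟨A, hA, hYA, rfl⟩
    exact Psi_nonneg p q (posSemidef_blockDiag2 hYA hA)⟩
  have hT0 : BddBelow T := ⟨0, by
    rintro s ⟨A, B, hA, hB, -, rfl⟩
    exact add_nonneg (Psi_nonneg p q hA) (Psi_nonneg p q hB)⟩
  change 1 / 2 * sInf T = sInf S
  rcases S.eq_empty_or_nonempty with hSe | hSn
  · have hTe : T = ∅ := Set.eq_empty_iff_forall_notMem.2 fun s hs => by
      obtain ⟨s', hs', -⟩ := hTS s hs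
      simp [hSe] at hs'
    simp [hSe, hTe]
  · have hTn : T.Nonempty := hSn.imp' (2 * ·) hST
    apply le_antisymm
    · refine le_csInf hSn fun s hs => ?_
      have := csInf_le hT0 (hST s hs)
      linarith
    · have : 2 * sInf S ≤ sInf T := le_csInf hTn fun s hs => by
        obtain ⟨s', hs', hle⟩ := hTS s hs
        have := csInf_le hS0 hs'
        linarith
      linarith
end
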